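/- Let D be a dumbbell consisting of two type 4 subdivisions of K_4 (in the Burling-admissible configuration), joined by a path of length ≥ 0 between the common endpoints x_1 and x_2 of the non-subdivided edges in each copy. Then no subdivision of D is a Burling graph, and consequently D is not weakly pervasive. -/

import Mathlib

namespace BurlingFormal

open SimpleGraph

/-- An orientation of a simple graph, given as a relation choosing a direction for each edge. -/
def IsOrientation {V : Type} (G : SimpleGraph V) (A : V → V → Prop) : Prop :=
  (∀ u v, A u v → G.Adj u v) ∧ (∀ u v, G.Adj u v → (A u v ↔ ¬ A v u))

/-- A chordless cycle: a cycle such that every adjacency between its vertices is a cycle edge. -/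
def IsChordlessCycle {V : Type} (G : SimpleGraph V) {v : V} (c : G.Walk v v) : Prop :=
  c.IsCycle ∧ ∀ x y, x ∈ c.support → y ∈ c.support → G.Adj x y → s(x, y) ∈ c.edges

/-- A hole: a chordless cycle of length at least 4. -/
def IsHole {V : Type} (G : SimpleGraph V) {v : V} (c : G.Walk v v) : Prop :=
  IsChordlessCycle G c ∧ 4 ≤ c.length

/-- A source of a hole w.r.t. an orientation: both its neighbours on the hole are out-neighbours. -/
def IsHoleSource {V : Type} {G : SimpleGraph V} {v : V} (A : V → V → Prop)
    (c : G.Walk v v) (x : V) : Prop :=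
  x ∈ c.support ∧ ∀ y, s(x, y) ∈ c.edges → A x y

/-- A sink of a hole w.r.t. an orientation: both its neighbours on the hole are in-neighbours. -/
def IsHoleSink {V : Type} {G : SimpleGraph V} {v : V} (A : V → V → Prop)
    (c : G.Walk v v) (x : V) : Prop :=
  x ∈ c.support ∧ ∀ y, s(x, y) ∈ c.edges → A y x

/-- An extremum of a hole: a source or a sink of it. -/
def IsHoleExtremum {V : Type} {G : SimpleGraph V} {v : V} (A : V → V → Prop)
    (c : G.Walk v v) (x : V) : Prop :=
  IsHoleSource A c x ∨ IsHoleSink A c x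

/-- The hole has exactly two sources and exactly two sinks. -/
def TwoSourcesTwoSinks {V : Type} {G : SimpleGraph V} {v : V} (A : V → V → Prop)
    (c : G.Walk v v) : Prop :=
  (∃ s₁ s₂, s₁ ≠ s₂ ∧ IsHoleSource A c s₁ ∧ IsHoleSource A c s₂ ∧
    ∀ s, IsHoleSource A c s → s = s₁ ∨ s = s₂) ∧
  (∃ t₁ t₂, t₁ ≠ t₂ ∧ IsHoleSink A c t₁ ∧ IsHoleSink A c t₂ ∧
    ∀ t, IsHoleSink A c t → t = t₁ ∨ t = t₂)

/-- The pivot of a hole: a sink adjacent on the hole to all of its sources. -/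
def IsHolePivot {V : Type} {G : SimpleGraph V} {v : V} (A : V → V → Prop)
    (c : G.Walk v v) (x : V) : Prop :=
  IsHoleSink A c x ∧ ∀ y, IsHoleSource A c y → s(x, y) ∈ c.edges

/-- A subordinate vertex of a hole: neither an antenna (source) nor the pivot. -/
def IsHoleSubordinate {V : Type} {G : SimpleGraph V} {v : V} (A : V → V → Prop)
    (c : G.Walk v v) (x : V) : Prop :=
  x ∈ c.support ∧ ¬ IsHoleSource A c x ∧ ¬ IsHolePivot A c x

/-- `S` is the vertex set of a (possibly empty) branch (downward path) starting at `u`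
in the rooted tree given by the parent function. -/
def IsBranchFrom {V : Type} (parent : V → V) (u : V) (S : Set V) : Prop :=
  S = ∅ ∨ (u ∈ S ∧ (∀ w ∈ S, w ≠ u → parent w ∈ S ∧ parent w ≠ w) ∧
    ∀ w ∈ S, ∀ w' ∈ S, w ≠ u → w' ≠ u → parent w = parent w' → w = w')

/-- A Burling tree: a rooted tree (given by a parent function) together with a last-born
function and a choose function assigning to each non-last-born non-root vertex the vertex set
of a branch starting at the last-born of its parent. -/
structure BurlingTree (V : Type) where
  parent : V → V
  root : V
  parent_root : parent root = root
  reach : ∀ v, ∃ n, parent^[n] v = root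
  lastBorn : V → V
  lastBorn_child : ∀ v, (∃ u, u ≠ v ∧ parent u = v) → parent (lastBorn v) = v ∧ lastBorn v ≠ v
  choosePath : V → Set V
  choosePath_empty : ∀ v, v = root ∨ v = lastBorn (parent v) → choosePath v = ∅
  choosePath_branch : ∀ v, v ≠ root → v ≠ lastBorn (parent v) →
    IsBranchFrom parent (lastBorn (parent v)) (choosePath v)

/-- The arcs of the oriented graph fully derived from a Burling tree. -/
def BurlingTree.Arc {V : Type} (T : BurlingTree V) (u v : V) : Prop :=
  v ∈ T.choosePath u

/-- `A` orients `G` so that `G` with this orientation is an oriented graph derived from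
some Burling tree (an oriented Burling graph). -/
def IsOrientedBurling {W : Type} (G : SimpleGraph W) (A : W → W → Prop) : Prop :=
  IsOrientation G A ∧
    ∃ (V : Type) (T : BurlingTree V) (f : W ↪ V), ∀ u v, A u v ↔ T.Arc (f u) (f v)

/-- A Burling graph (equivalently, a derived graph): the underlying graph of an oriented
graph derived from a Burling tree. -/
def IsBurlingGraph {W : Type} (G : SimpleGraph W) : Prop :=
  ∃ A, IsOrientedBurling G A

/-- A global subordinate vertex of a Burling graph: subordinate in some hole, for every
orientation of the graph as an oriented Burling graph. -/
def IsGlobalSubordinate {W : Type} (G : SimpleGraph W) (x : W) : Prop :=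
  ∀ A, IsOrientedBurling G A →
    ∃ (v : W) (c : G.Walk v v), IsHole G c ∧ IsHoleSubordinate A c x

/-- `H` is a subdivision of `G` via the branch-vertex embedding `f` and the system of
paths `P` replacing the edges of `G`. -/
def IsSubdivisionVia {V W : Type} (H : SimpleGraph W) (G : SimpleGraph V) (f : V ↪ W)
    (P : ∀ ⦃u v : V⦄, G.Adj u v → H.Walk (f u) (f v)) : Prop :=
  (∀ ⦃u v⦄ (h : G.Adj u v), (P h).IsPath ∧ 1 ≤ (P h).length) ∧
  (∀ ⦃u v⦄ (h : G.Adj u v) (x : V), f x ∈ (P h).support → x = u ∨ x = v) ∧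
  (∀ ⦃u v u' v'⦄ (h : G.Adj u v) (h' : G.Adj u' v'), s(u, v) ≠ s(u', v') →
    ∀ w, w ∈ (P h).support → w ∈ (P h').support → ∃ x : V, w = f x) ∧
  (∀ w : W, ∃ u v, ∃ h : G.Adj u v, w ∈ (P h).support) ∧
  (∀ ⦃x y : W⦄, H.Adj x y → ∃ u v, ∃ h : G.Adj u v, s(x, y) ∈ (P h).edges)

/-- `H` is a subdivision of `G`. -/
def IsSubdivision {V W : Type} (H : SimpleGraph W) (G : SimpleGraph V) : Prop :=
  ∃ (f : V ↪ W) (P : ∀ ⦃u v : V⦄, G.Adj u v → H.Walk (f u) (f v)), IsSubdivisionVia H G f P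

/-- `G` contains an induced copy of `H`. -/
def InducedCopy {V W : Type} (H : SimpleGraph W) (G : SimpleGraph V) : Prop :=
  ∃ f : W ↪ V, ∀ a b, H.Adj a b ↔ G.Adj (f a) (f b)

/-- The clique number of a graph. -/
noncomputable def cliqueNumber {V : Type} (G : SimpleGraph V) : ℕ :=
  sSup {n | ∃ s : Finset V, G.IsNClique n s}

/-- `G` belongs to `Forb*(H)`: it has no induced subdivision of `H`. -/
def InForbs {VH V : Type} (H : SimpleGraph VH) (G : SimpleGraph V) : Prop :=
  ∀ (U : Type) (S : SimpleGraph U), IsSubdivision S H → ¬ InducedCopy S G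

/-- `H` is weakly pervasive: the class `Forb*(H)` (of finite graphs) is χ-bounded. -/
def WeaklyPervasive {VH : Type} (H : SimpleGraph VH) : Prop :=
  ∃ f : ℕ → ℕ, ∀ (V : Type) (_ : Fintype V) (G : SimpleGraph V),
    InForbs H G → G.chromaticNumber ≤ (f (cliqueNumber G) : ℕ∞)

/-- `G` has a star cutset centered at `v`. -/
def HasStarCutsetAt {V : Type} (G : SimpleGraph V) (v : V) : Prop :=
  ∃ S : Set V, v ∈ S ∧ (∀ u ∈ S, u = v ∨ G.Adj v u) ∧ ¬ (G.induce Sᶜ).Preconnected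

/-- `G` has a star cutset. -/
def HasStarCutset {V : Type} (G : SimpleGraph V) : Prop :=
  ∃ v, HasStarCutsetAt G v

/-- The structure of an `m`-necklace on the graph `G`: beads `B i` (chordless cycles of
length at least 4 through the non-adjacent vertices `a i`, `b i`) joined cyclically by
paths `P i` from `b i` to `a (i+1)` (of length possibly 0, i.e. identification),
with no further vertices or edges. -/
structure Necklace {V : Type} (G : SimpleGraph V) (m : ℕ) where
  a : ZMod m → V
  b : ZMod m → V
  B : ∀ i, G.Walk (a i) (a i)
  P : ∀ i, G.Walk (b i) (a (i + 1))
  B_cycle : ∀ i, (B i).IsCycle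
  B_len : ∀ i, 4 ≤ (B i).length
  b_mem : ∀ i, b i ∈ (B i).support
  ab_ne : ∀ i, a i ≠ b i
  ab_nonadj : ∀ i, ¬ G.Adj (a i) (b i)
  P_path : ∀ i, (P i).IsPath
  bead_disjoint : ∀ i j, i ≠ j → ∀ x, x ∈ (B i).support → x ∈ (B j).support →
    (j = i + 1 ∧ x = b i ∧ x = a j) ∨ (i = j + 1 ∧ x = b j ∧ x = a i)
  path_bead_disjoint : ∀ i j (x : V), x ∈ (P i).support → x ∈ (B j).support →
    x = b i ∨ x = a (i + 1)
  path_disjoint : ∀ i j, i ≠ j → ∀ x, x ∈ (P i).support → x ∈ (P j).support →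
    (x = b i ∨ x = a (i + 1)) ∧ (x = b j ∨ x = a (j + 1))
  cover_vertex : ∀ x : V, (∃ i, x ∈ (B i).support) ∨ ∃ i, x ∈ (P i).support
  cover_edge : ∀ x y, G.Adj x y → (∃ i, s(x, y) ∈ (B i).edges) ∨ ∃ i, s(x, y) ∈ (P i).edges

/-- The bead `B i` of a necklace is short if `a i` and `b i` have a common neighbour. -/
def Necklace.Short {V : Type} {G : SimpleGraph V} {m : ℕ} (N : Necklace G m)
    (i : ZMod m) : Prop :=
  ∃ w, G.Adj (N.a i) w ∧ G.Adj (N.b i) w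

/-- A chandelier: an in-tree (given by a parent function on `V \ {hub}`) with at least two
leaves, together with an extra vertex `hub` joined to all the leaves. -/
structure Chandelier (V : Type) where
  hub : V
  root : V
  parent : V → V
  hub_ne_root : hub ≠ root
  parent_root : parent root = root
  parent_hub : parent hub = hub
  parent_ne_hub : ∀ u, u ≠ hub → parent u ≠ hub
  reach : ∀ u, u ≠ hub → ∃ n, parent^[n] u = root
  two_leaves : ∃ l₁ l₂ : V, l₁ ≠ l₂ ∧
    (l₁ ≠ hub ∧ l₁ ≠ root ∧ ∀ w, parent w = l₁ → w = l₁) ∧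
    (l₂ ≠ hub ∧ l₂ ≠ root ∧ ∀ w, parent w = l₂ → w = l₂)

/-- A leaf of the in-tree of a chandelier. -/
def Chandelier.IsLeaf {V : Type} (C : Chandelier V) (u : V) : Prop :=
  u ≠ C.hub ∧ u ≠ C.root ∧ ∀ w, C.parent w = u → w = u

/-- The arcs of (the oriented version of) a chandelier. -/
def Chandelier.Arc {V : Type} (C : Chandelier V) (u w : V) : Prop :=
  (u ≠ C.hub ∧ u ≠ C.root ∧ w = C.parent u) ∨ (C.IsLeaf u ∧ w = C.hub)

/-- The underlying (non-oriented) graph of a chandelier. -/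
def Chandelier.graph {V : Type} (C : Chandelier V) : SimpleGraph V :=
  SimpleGraph.fromRel C.Arc

/-- There is a vertex lying on every cycle of the graph. -/
def HasUniversalCycleVertex {V : Type} (G : SimpleGraph V) : Prop :=
  ∃ x : V, ∀ (w : V) (c : G.Walk w w), c.IsCycle → x ∈ c.support

/-- A Burling-admissible type-4 subdivision of `K₄` sitting inside `G`: branch vertices
`x, y, z, w`, where the two non-subdivided edges `xy`, `xz` share the endpoint `x`, and the
four other edges are replaced by internally disjoint paths of length at least 2. -/
structure Type4K4Core {V : Type} (G : SimpleGraph V) where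
  x : V
  y : V
  z : V
  w : V
  ne_xy : x ≠ y
  ne_xz : x ≠ z
  ne_xw : x ≠ w
  ne_yz : y ≠ z
  ne_yw : y ≠ w
  ne_zw : z ≠ w
  adj_xy : G.Adj x y
  adj_xz : G.Adj x z
  Pxw : G.Walk x w
  Pyz : G.Walk y z
  Pyw : G.Walk y w
  Pzw : G.Walk z w
  Pxw_path : Pxw.IsPath
  Pyz_path : Pyz.IsPath
  Pyw_path : Pyw.IsPath
  Pzw_path : Pzw.IsPath
  Pxw_len : 2 ≤ Pxw.length
  Pyz_len : 2 ≤ Pyz.length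
  Pyw_len : 2 ≤ Pyw.length
  Pzw_len : 2 ≤ Pzw.length
  d₁ : ∀ v, v ∈ Pxw.support → v ∈ Pyz.support → False
  d₂ : ∀ v, v ∈ Pxw.support → v ∈ Pyw.support → v = w
  d₃ : ∀ v, v ∈ Pxw.support → v ∈ Pzw.support → v = w
  d₄ : ∀ v, v ∈ Pyz.support → v ∈ Pyw.support → v = y
  d₅ : ∀ v, v ∈ Pyz.support → v ∈ Pzw.support → v = z
  d₆ : ∀ v, v ∈ Pyw.support → v ∈ Pzw.support → v = w

/-- The vertex set of a type-4 `K₄`-subdivision configuration. -/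
def Type4K4Core.supp {V : Type} {G : SimpleGraph V} (c : Type4K4Core G) : Set V :=
  {v | v ∈ c.Pxw.support ∨ v ∈ c.Pyz.support ∨ v ∈ c.Pyw.support ∨ v ∈ c.Pzw.support}

/-- The edge set of a type-4 `K₄`-subdivision configuration. -/
def Type4K4Core.edges {V : Type} {G : SimpleGraph V} (c : Type4K4Core G) : Set (Sym2 V) :=
  {e | e ∈ c.Pxw.edges ∨ e ∈ c.Pyz.edges ∨ e ∈ c.Pyw.edges ∨ e ∈ c.Pzw.edges ∨
    e = s(c.x, c.y) ∨ e = s(c.x, c.z)}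

/-- The configuration exhausts the whole graph `G`. -/
def Type4K4Core.Spanning {V : Type} {G : SimpleGraph V} (c : Type4K4Core G) : Prop :=
  (∀ v : V, v ∈ c.supp) ∧ ∀ u v, G.Adj u v → s(u, v) ∈ c.edges

/-- A vertex of degree exactly 2. -/
def DegTwo {V : Type} (G : SimpleGraph V) (x : V) : Prop :=
  ∃ p q, p ≠ q ∧ G.Adj x p ∧ G.Adj x q ∧ ∀ r, G.Adj x r → r = p ∨ r = q



namespace BurlingTree
variable {V : Type} (T : BurlingTree V)

open Classical in
noncomputable def dep (v : V) : ℕ := Nat.find (T.reach v)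

theorem iter_root (n : ℕ) : T.parent^[n] T.root = T.root := by
  induction n with
  | zero => rfl
  | succ n ih => rw [Function.iterate_succ_apply, T.parent_root, ih]

theorem dep_spec (v : V) : T.parent^[T.dep v] v = T.root := by
  classical
  exact Nat.find_spec (T.reach v)

theorem dep_le {v : V} {n : ℕ} (h : T.parent^[n] v = T.root) : T.dep v ≤ n := by
  classical
  exact Nat.find_min' (T.reach v) h

theorem dep_root : T.dep T.root = 0 := Nat.le_zero.1 (T.dep_le rfl)

theorem eq_root_of_dep {v : V} (h : T.dep v = 0) : v = T.root := by
  have := T.dep_spec v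
  rwa [h] at this

theorem dep_parent {v : V} (h : v ≠ T.root) : T.dep v = T.dep (T.parent v) + 1 := by
  have h1 : T.dep v ≤ T.dep (T.parent v) + 1 := by
    apply T.dep_le
    rw [Function.iterate_succ_apply]
    exact T.dep_spec _
  have h2 : T.dep v ≠ 0 := fun h' => h (T.eq_root_of_dep h')
  have h3 : T.dep (T.parent v) ≤ T.dep v - 1 := by
    apply T.dep_le
    rw [← Function.iterate_succ_apply, Nat.succ_eq_add_one, Nat.sub_add_cancel (by omega)]
    exact T.dep_spec _
  omega

theorem dep_iter (v : V) (n : ℕ) : T.dep (T.parent^[n] v) = T.dep v - n := by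
  induction n generalizing v with
  | zero => rfl
  | succ n ih =>
    rw [Function.iterate_succ_apply, ih]
    by_cases h : v = T.root
    · subst h; rw [T.parent_root, T.dep_root]; omega
    · rw [T.dep_parent h]; omega

/-- `u` is an ancestor of (or equal to) `v`. -/
def Anc (u v : V) : Prop := ∃ n, T.parent^[n] v = u

theorem Anc.refl (u : V) : T.Anc u u := ⟨0, rfl⟩

theorem Anc.trans {u v w : V} (h : T.Anc u v) (h' : T.Anc v w) : T.Anc u w := by
  obtain ⟨n, rfl⟩ := h
  obtain ⟨m, rfl⟩ := h'
  exact ⟨n + m, Function.iterate_add_apply _ _ _ _⟩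

theorem Anc.dep_le {u v : V} (h : T.Anc u v) : T.dep u ≤ T.dep v := by
  obtain ⟨n, rfl⟩ := h
  rw [dep_iter]; omega

theorem Anc.eq_of_dep {u v : V} (h : T.Anc u v) (hd : T.dep v ≤ T.dep u) : u = v := by
  obtain ⟨n, rfl⟩ := h
  rw [dep_iter] at hd
  rcases Nat.eq_zero_or_pos n with rfl | hn
  · rfl
  · have : v = T.root := T.eq_root_of_dep (by omega)
    subst this
    exact T.iter_root n

theorem Anc.antisymm {u v : V} (h : T.Anc u v) (h' : T.Anc v u) : u = v :=
  Anc.eq_of_dep T h (Anc.dep_le T h')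

theorem Anc.eq_iter {u v : V} (h : T.Anc u v) : T.parent^[T.dep v - T.dep u] v = u := by
  obtain ⟨n, rfl⟩ := h
  rw [dep_iter]
  by_cases hn : n ≤ T.dep v
  · congr 1; omega
  · have : T.dep v - (T.dep v - n) = T.dep v := by omega
    rw [this, T.dep_spec]
    have : n = (n - T.dep v) + T.dep v := by omega
    rw [this, Function.iterate_add_apply, T.dep_spec, iter_root]

theorem anc_total {u v w : V} (h : T.Anc u w) (h' : T.Anc v w) (hd : T.dep u ≤ T.dep v) :
    T.Anc u v := by
  have h1 := Anc.eq_iter T h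
  have h2 := Anc.eq_iter T h'
  have := Anc.dep_le T h'
  refine ⟨T.dep v - T.dep u, ?_⟩
  have h3 : T.parent^[T.dep v - T.dep u] (T.parent^[T.dep w - T.dep v] w) = u := by
    rw [← Function.iterate_add_apply,
      show T.dep v - T.dep u + (T.dep w - T.dep v) = T.dep w - T.dep u by omega]
    exact h1
  rwa [h2] at h3

/-- base of the chosen branch -/
def base (u : V) : V := T.lastBorn (T.parent u)

theorem parent_ne {u : V} (h : u ≠ T.root) : T.parent u ≠ u := by
  intro h'
  have := T.dep_parent h
  rw [h'] at this
  omega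

theorem arc_basic {u v : V} (h : T.Arc u v) :
    u ≠ T.root ∧ u ≠ T.base u ∧ T.base u ≠ T.root ∧ T.parent (T.base u) = T.parent u ∧
    T.dep (T.base u) = T.dep u := by
  unfold Arc at h
  have h1 : u ≠ T.root := by
    intro h'
    rw [T.choosePath_empty u (Or.inl h')] at h
    exact h
  have h2 : u ≠ T.base u := by
    intro h'
    rw [T.choosePath_empty u (Or.inr h')] at h
    exact h
  have h3 := T.lastBorn_child (T.parent u) ⟨u, (T.parent_ne h1).symm, rfl⟩
  have h4 : T.base u ≠ T.root := by
    intro h'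
    have := h3.1
    unfold base at h'
    rw [h', T.parent_root] at this
    exact h3.2 (h'.trans this)
  refine ⟨h1, h2, h4, h3.1, ?_⟩
  rw [T.dep_parent h1, T.dep_parent h4]
  unfold base
  rw [h3.1]

theorem arc_mem {u v : V} (h : T.Arc u v) :
    T.base u ∈ T.choosePath u ∧
      (∀ w ∈ T.choosePath u, w ≠ T.base u → T.parent w ∈ T.choosePath u ∧ T.parent w ≠ w) ∧
    ∀ w ∈ T.choosePath u, ∀ w' ∈ T.choosePath u, w ≠ T.base u → w' ≠ T.base u →
      T.parent w = T.parent w' → w = w' := by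
  obtain ⟨h1, h2, -⟩ := T.arc_basic h
  rcases T.choosePath_branch u h1 h2 with h3 | h3
  · unfold Arc at h
    rw [h3] at h
    exact h.elim
  · exact h3

theorem arc_anc {u v : V} (h : T.Arc u v) : T.Anc (T.base u) v := by
  obtain ⟨n, hn⟩ := T.reach v
  induction n generalizing v with
  | zero =>
    by_cases hv : v = T.base u
    · exact ⟨0, hv⟩
    · have := ((T.arc_mem h).2.1 v h hv).2
      simp at hn
      subst hn
      exact (this T.parent_root).elim
  | succ n ih =>
    by_cases hv : v = T.base u
    · exact ⟨0, hv⟩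
    · have := ((T.arc_mem h).2.1 v h hv).1
      obtain ⟨m, hm⟩ := ih this hn
      exact ⟨m + 1, hm⟩

theorem arc_up {u v : V} (h : T.Arc u v) (n : ℕ) (hn : n ≤ T.dep v - T.dep (T.base u)) :
    T.Arc u (T.parent^[n] v) := by
  induction n with
  | zero => exact h
  | succ n ih =>
    have h1 := ih (by omega)
    rw [Function.iterate_succ_apply']
    refine ((T.arc_mem h).2.1 _ h1 ?_).1
    intro h2
    have := T.dep_iter v n
    rw [h2] at this
    omega

theorem arc_dep_le {u v : V} (h : T.Arc u v) : T.dep (T.base u) ≤ T.dep v :=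
  Anc.dep_le T (T.arc_anc h)

theorem arc_unique {u v w : V} (h : T.Arc u v) (h' : T.Arc u w) (hd : T.dep v = T.dep w) :
    v = w := by
  obtain ⟨n, hn⟩ : ∃ n, T.dep v = T.dep (T.base u) + n := ⟨_, (Nat.add_sub_cancel' (T.arc_dep_le h)).symm⟩
  induction n generalizing v w with
  | zero =>
    rw [← Anc.eq_of_dep T (T.arc_anc h) (by omega), ← Anc.eq_of_dep T (T.arc_anc h') (by omega)]
  | succ n ih =>
    have hv : v ≠ T.base u := by rintro rfl; omega
    have hw : w ≠ T.base u := by rintro rfl; omega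
    have hvr : v ≠ T.root := by rintro rfl; rw [T.dep_root] at hn; omega
    have hwr : w ≠ T.root := by rintro rfl; rw [T.dep_root] at hd; omega
    have e1 := T.dep_parent hvr
    have e2 := T.dep_parent hwr
    obtain ⟨-, h2, h3⟩ := T.arc_mem h
    exact h3 v h w h' hv hw (ih (h2 v h hv).1 (h2 w h' hw).1 (by omega) (by omega))

theorem arc_chain {u v w : V} (h : T.Arc u v) (h' : T.Arc u w) (hd : T.dep v ≤ T.dep w) :
    T.Anc v w := by
  have h0 := T.arc_dep_le h
  have h1 := T.arc_up h' (T.dep w - T.dep v) (by omega)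
  refine ⟨T.dep w - T.dep v, (T.arc_unique h h1 ?_).symm⟩
  rw [T.dep_iter]; omega

theorem arc_rank {u v : V} (h : T.Arc u v) :
    T.dep u < T.dep v ∨ (T.dep u = T.dep v ∧ v = T.base u) := by
  have h0 := T.arc_dep_le h
  obtain ⟨h1, h2, h3, h4, h5⟩ := T.arc_basic h
  rcases Nat.lt_or_ge (T.dep u) (T.dep v) with h6 | h6
  · exact Or.inl h6
  · right
    exact ⟨by omega, (Anc.eq_of_dep T (T.arc_anc h) (by omega)).symm⟩

open Classical in
noncomputable def rk (v : V) : ℕ := 2 * T.dep v + if v = T.base v then 1 else 0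

theorem arc_rk {u v : V} (h : T.Arc u v) : T.rk u < T.rk v := by
  obtain ⟨h1, h2, h3, h4, h5⟩ := T.arc_basic h
  unfold rk
  rw [if_neg h2]
  rcases T.arc_rank h with h6 | ⟨h6, h7⟩
  · omega
  · have : v = T.base v := by
      rw [h7]
      change T.base u = T.lastBorn (T.parent (T.base u))
      rw [h4]; rfl
    rw [if_pos this]
    omega

theorem arc_not_anc {u v : V} (h : T.Arc u v) : ¬ T.Anc u v ∧ ¬ T.Anc v u := by
  obtain ⟨h1, h2, h3, h4, h5⟩ := T.arc_basic h
  have h6 : ¬ T.Anc u v := by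
    intro h7
    have h8 := T.anc_total h7 (T.arc_anc h) (by omega)
    exact h2 (Anc.eq_of_dep T h8 (by omega))
  refine ⟨h6, fun h7 => ?_⟩
  have := T.arc_dep_le h
  have h8 := Anc.eq_of_dep T h7 (by omega)
  subst h8
  exact h6 h7

theorem arc_sep_in {a b v : V} (h : T.Arc a b) (hb : T.Anc v b) (ha : ¬ T.Anc v a) :
    T.Arc a v := by
  obtain ⟨h1, h2, h3, h4, h5⟩ := T.arc_basic h
  have h6 := T.arc_anc h
  rcases Nat.lt_or_ge (T.dep v) (T.dep (T.base a)) with h7 | h7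
  · exfalso
    obtain ⟨n, hn⟩ := T.anc_total hb h6 h7.le
    rcases n with _ | n
    · simp at hn
      rw [hn] at h7
      omega
    · rw [Function.iterate_succ_apply, h4] at hn
      exact ha ⟨n + 1, hn⟩
  · have := T.arc_up h (T.dep b - T.dep v) (by omega)
    rwa [Anc.eq_iter T hb] at this

theorem arc_sep_out {a b v : V} (h : T.Arc b a) (hb : T.Anc v b) (ha : ¬ T.Anc v a) : b = v := by
  obtain ⟨h1, h2, h3, h4, h5⟩ := T.arc_basic h
  obtain ⟨n, hn⟩ := hb
  rcases n with _ | n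
  · exact hn
  · exfalso
    apply ha
    refine Anc.trans T ⟨n, hn⟩ (Anc.trans T (v := T.base b) ⟨1, h4⟩ (T.arc_anc h))

end BurlingTree

/-- The order-theoretic properties of an oriented Burling graph used below. -/
structure BOrd {W : Type} (H : SimpleGraph W) (A : W → W → Prop) (le : W → W → Prop) : Prop where
  refl : ∀ u, le u u
  trans : ∀ u v w, le u v → le v w → le u w
  antisymm : ∀ u v, le u v → le v u → u = v
  adj : ∀ u v, H.Adj u v ↔ A u v ∨ A v u
  asymm : ∀ u v, A u v → ¬ A v u
  chain : ∀ s u v, A s u → A s v → le u v ∨ le v u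
  sep : ∀ a b v, H.Adj a b → le v b → ¬ le v a → b = v ∨ (A a v ∧ A a b)
  nadj : ∀ a b, H.Adj a b → ¬ le a b
  rank : ∃ r : W → ℕ, ∀ u v, A u v → r u < r v

theorem exists_BOrd {W : Type} {H : SimpleGraph W} (h : IsBurlingGraph H) :
    ∃ A le, BOrd H A le := by
  obtain ⟨A, ⟨ho1, ho2⟩, V, T, f, hA⟩ := h
  have hadj : ∀ u v, H.Adj u v ↔ A u v ∨ A v u := by
    intro u v
    constructor
    · intro h
      by_cases h1 : A v u
      · exact Or.inr h1
      · exact Or.inl ((ho2 u v h).2 h1)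
    · rintro (h | h)
      · exact ho1 _ _ h
      · exact (ho1 _ _ h).symm
  refine ⟨A, fun u v => T.Anc (f u) (f v), ?_⟩
  refine ⟨fun u => .refl T _, fun u v w => .trans T, fun u v h h' => f.injective (BurlingTree.Anc.antisymm T h h'),
    hadj, ?_, ?_, ?_, ?_, ⟨fun u => T.rk (f u), fun u v h => T.arc_rk ((hA u v).1 h)⟩⟩
  · intro u v h
    exact (ho2 u v (ho1 _ _ h)).1 h
  · intro s u v h h'
    rw [hA] at h h'
    rcases le_total (T.dep (f u)) (T.dep (f v)) with h1 | h1
    · exact Or.inl (T.arc_chain h h' h1)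
    · exact Or.inr (T.arc_chain h' h h1)
  · intro a b v h hb ha
    rcases (hadj a b).1 h with h1 | h1
    · right
      refine ⟨(hA a v).2 (T.arc_sep_in ((hA a b).1 h1) hb ha), h1⟩
    · left
      exact f.injective (T.arc_sep_out ((hA b a).1 h1) hb ha)
  · intro a b h h'
    rcases (hadj a b).1 h with h1 | h1
    · exact (T.arc_not_anc ((hA _ _).1 h1)).1 h'
    · exact (T.arc_not_anc ((hA _ _).1 h1)).2 h'



/-- `X` is the vertex set of an induced path from `a` to `b` (of length at least one). -/
def PP {W : Type} (H : SimpleGraph W) (X : Set W) (a b : W) : Prop :=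
  ∃ (n : ℕ) (p : ℕ → W), 1 ≤ n ∧ p 0 = a ∧ p n = b ∧ (∀ i ≤ n, ∀ j ≤ n, p i = p j → i = j) ∧
    (∀ w, w ∈ X ↔ ∃ i ≤ n, p i = w) ∧
    (∀ i ≤ n, ∀ j ≤ n, H.Adj (p i) (p j) ↔ j = i + 1 ∨ i = j + 1)

section PPsec
variable {W : Type} {H : SimpleGraph W} {X : Set W} {a b : W}

theorem PP.symm (h : PP H X a b) : PP H X b a := by
  obtain ⟨n, p, hn, h0, h1, hi, hX, hA⟩ := h
  refine ⟨n, fun i => p (n - i), hn, by simpa using h1, by simpa using h0, ?_, ?_, ?_⟩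
  · intro i hi' j hj h
    have := hi _ (by omega) _ (by omega) h
    omega
  · intro w
    rw [hX]
    constructor
    · rintro ⟨i, hi, rfl⟩
      exact ⟨n - i, by omega, by dsimp only; congr 1; omega⟩
    · rintro ⟨i, hi, rfl⟩
      exact ⟨n - i, by omega, rfl⟩
  · intro i hi' j hj
    rw [hA _ (by omega) _ (by omega)]
    omega

theorem PP.left (h : PP H X a b) : a ∈ X := by
  obtain ⟨n, p, hn, h0, h1, hi, hX, hA⟩ := h
  exact (hX a).2 ⟨0, by omega, h0⟩

theorem PP.right (h : PP H X a b) : b ∈ X := h.symm.left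

theorem PP.end_nbr (h : PP H X a b) : ∃ c ∈ X, H.Adj a c ∧ ∀ d ∈ X, H.Adj a d → d = c := by
  obtain ⟨n, p, hn, h0, h1, hi, hX, hA⟩ := h
  refine ⟨p 1, (hX _).2 ⟨1, hn, rfl⟩, ?_, ?_⟩
  · rw [← h0, hA _ (by omega) _ (by omega)]; omega
  · intro d hd had
    obtain ⟨i, hi, rfl⟩ := (hX _).1 hd
    rw [← h0, hA _ (by omega) _ (by omega)] at had
    congr 1; omega

theorem PP.int_nbr (h : PP H X a b) {s : W} (hs : s ∈ X) (hsa : s ≠ a) (hsb : s ≠ b) :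
    ∃ u ∈ X, ∃ v ∈ X, u ≠ v ∧ H.Adj s u ∧ H.Adj s v ∧ ∀ d ∈ X, H.Adj s d → d = u ∨ d = v := by
  obtain ⟨n, p, hn, h0, h1, hi, hX, hA⟩ := h
  obtain ⟨k, hk, rfl⟩ := (hX _).1 hs
  have hk0 : k ≠ 0 := by rintro rfl; exact hsa h0
  have hkn : k ≠ n := by rintro rfl; exact hsb h1
  refine ⟨p (k-1), (hX _).2 ⟨k-1, by omega, rfl⟩, p (k+1), (hX _).2 ⟨k+1, by omega, rfl⟩, ?_, ?_, ?_, ?_⟩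
  · intro h
    have := hi _ (by omega) _ (by omega) h
    omega
  · rw [hA _ (by omega) _ (by omega)]; omega
  · rw [hA _ (by omega) _ (by omega)]; omega
  · intro d hd had
    obtain ⟨i, hi, rfl⟩ := (hX _).1 hd
    rw [hA _ (by omega) _ (by omega)] at had
    rcases had with h | h
    · right; congr 1
    · left; congr 1; omega

/-- spreading away from `a`, except possibly to `b` -/
theorem PP.spread_but (h : PP H X a b) {Z : Set W}
    (hZ : ∀ z ∈ Z, z ∈ X → ∀ c ∈ X, c ≠ b → H.Adj z c → c ∈ Z) (ha : a ∈ Z) :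
    ∀ t ∈ X, t ≠ b → t ∈ Z := by
  obtain ⟨n, p, hn, h0, h1, hi, hX, hA⟩ := h
  intro t ht htb
  obtain ⟨k, hk, rfl⟩ := (hX _).1 ht
  induction k with
  | zero => rwa [h0]
  | succ k ih =>
    have hkX : p k ∈ X := (hX _).2 ⟨k, by omega, rfl⟩
    have := ih (by omega) hkX (by
      intro h2
      rw [← h1] at h2
      have := hi _ (by omega) _ (by omega) h2
      omega)
    refine hZ _ this hkX _ ht htb ?_
    rw [hA _ (by omega) _ (by omega)]
    omega

theorem PP.spread_all (h : PP H X a b) {Z : Set W}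
    (hZ : ∀ z ∈ Z, z ∈ X → ∀ c ∈ X, H.Adj z c → c ∈ Z) (ha : a ∈ Z) :
    ∀ t ∈ X, t ∈ Z := by
  have h1 := h.spread_but (Z := Z) (fun z hz hzX c hc _ => hZ z hz hzX c hc) ha
  intro t ht
  by_cases htb : t = b
  · subst htb
    obtain ⟨c, hc, hac, -⟩ := h.symm.end_nbr
    exact hZ c (h1 c hc hac.ne') hc _ ht hac.symm
  · exact h1 t ht htb

/-- from both ends -/
theorem PP.spread_in (h : PP H X a b) {Z : Set W} {s : W}
    (hZ : ∀ z ∈ Z, z ∈ X → ∀ c ∈ X, c ≠ s → H.Adj z c → c ∈ Z) (ha : a ∈ Z ∨ a = s)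
    (hb : b ∈ Z ∨ b = s) : ∀ t ∈ X, t ≠ s → t ∈ Z := by
  obtain ⟨n, p, hn, h0, h1, hi, hX, hA⟩ := h
  -- either the initial segment up to k is free of s or the final one
  have key1 : ∀ k ≤ n, (∀ i ≤ k, p i ≠ s) → p k ∈ Z := by
    intro k
    induction k with
    | zero =>
      intro _ h
      have := h 0 le_rfl
      rw [h0] at this ⊢
      tauto
    | succ k ih =>
      intro hk h
      refine hZ _ (ih (by omega) (fun i hi => h i (by omega))) ((hX _).2 ⟨k, by omega, rfl⟩) _
        ((hX _).2 ⟨k + 1, by omega, rfl⟩) (h _ le_rfl) ?_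
      rw [hA _ (by omega) _ (by omega)]; omega
  have key2 : ∀ k ≤ n, (∀ i ≤ k, p (n - i) ≠ s) → p (n - k) ∈ Z := by
    intro k
    induction k with
    | zero =>
      intro _ h
      have := h 0 le_rfl
      simp only [Nat.sub_zero, h1] at this ⊢
      tauto
    | succ k ih =>
      intro hk h
      refine hZ _ (ih (by omega) (fun i hi => h i (by omega))) ((hX _).2 ⟨n - k, by omega, rfl⟩) _
        ((hX _).2 ⟨n - (k + 1), by omega, rfl⟩) (h _ le_rfl) ?_
      rw [hA _ (by omega) _ (by omega)]; omega
  intro t ht hts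
  obtain ⟨k, hk, rfl⟩ := (hX _).1 ht
  by_cases hc : ∃ i ≤ k, p i = s
  · obtain ⟨j, hj, rfl⟩ := hc
    have := key2 (n - k) (by omega) (by
      intro i hi' h2
      have := hi _ (by omega) _ (by omega) h2
      have : j ≠ k := by rintro rfl; exact hts rfl
      omega)
    rwa [show n - (n - k) = k by omega] at this
  · push Not at hc
    exact key1 k hk hc

/-- an element of a closed set propagates to one of the ends -/
theorem PP.spread_out (h : PP H X a b) {Z : Set W} {s : W}
    (hZ : ∀ z ∈ Z, z ∈ X → ∀ c ∈ X, c ≠ s → H.Adj z c → c ∈ Z) {t : W} (ht : t ∈ X)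
    (htZ : t ∈ Z) (hts : t ≠ s) : a ∈ Z ∨ b ∈ Z := by
  obtain ⟨n, p, hn, h0, h1, hi, hX, hA⟩ := h
  obtain ⟨k, hk, rfl⟩ := (hX _).1 ht
  by_cases hc : ∃ i ≤ k, p i = s
  · right
    obtain ⟨j, hj, rfl⟩ := hc
    have key : ∀ m, k + m ≤ n → p (k + m) ∈ Z := by
      intro m
      induction m with
      | zero => intro _; exact htZ
      | succ m ih =>
        intro hm
        refine hZ _ (ih (by omega)) ((hX _).2 ⟨k + m, by omega, rfl⟩) _
          ((hX _).2 ⟨k + (m + 1), by omega, rfl⟩) ?_ ?_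
        · intro h2
          have := hi _ (by omega) _ (by omega) h2
          omega
        · rw [hA _ (by omega) _ (by omega)]; omega
    have := key (n - k) (by omega)
    rwa [show k + (n - k) = n by omega, h1] at this
  · left
    push Not at hc
    have key : ∀ m ≤ k, p (k - m) ∈ Z := by
      intro m
      induction m with
      | zero => intro _; exact htZ
      | succ m ih =>
        intro hm
        refine hZ _ (ih (by omega)) ((hX _).2 ⟨k - m, by omega, rfl⟩) _
          ((hX _).2 ⟨k - (m + 1), by omega, rfl⟩) (hc _ (by omega)) ?_
        rw [hA _ (by omega) _ (by omega)]; omega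
    have := key k le_rfl
    rwa [Nat.sub_self, h0] at this

end PPsec

/-- vertex set of a chordless cycle -/
structure HoleSet {W : Type} (H : SimpleGraph W) (C : Set W) : Prop where
  ne : C.Nonempty
  nb : ∀ s ∈ C, ∃ u ∈ C, ∃ v ∈ C, u ≠ v ∧ H.Adj s u ∧ H.Adj s v ∧
    ∀ d ∈ C, H.Adj s d → d = u ∨ d = v
  conn : ∀ s ∈ C, ∀ Z : Set W, (∀ z ∈ Z, z ∈ C ∧ z ≠ s) → Z.Nonempty →
    (∀ z ∈ Z, ∀ c ∈ C, c ≠ s → H.Adj z c → c ∈ Z) → ∀ c ∈ C, c ≠ s → c ∈ Z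

/-- pivot `v` and antennas `s`, `a` of a hole -/
structure HD {W : Type} (H : SimpleGraph W) (A le : W → W → Prop) (C : Set W) (v s a : W) :
    Prop where
  hv : v ∈ C
  hs : s ∈ C
  ha : a ∈ C
  sa : s ≠ a
  sv : A s v
  av : A a v
  nbv : ∀ c ∈ C, H.Adj v c → c = s ∨ c = a
  srcs : ∀ c ∈ C, H.Adj s c → A s c
  srca : ∀ c ∈ C, H.Adj a c → A a c
  sub : ∀ c ∈ C, c ≠ s → c ≠ v → c ≠ a → le v c

theorem HoleSet.nb' {W : Type} {H : SimpleGraph W} {C : Set W} (h : HoleSet H C) {s u : W}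
    (hs : s ∈ C) (hu : u ∈ C) (hsu : H.Adj s u) :
    ∃ v ∈ C, u ≠ v ∧ H.Adj s v ∧ ∀ d ∈ C, H.Adj s d → d = u ∨ d = v := by
  obtain ⟨p, hp, q, hq, hpq, h1, h2, h3⟩ := h.nb s hs
  rcases h3 u hu hsu with rfl | rfl
  · exact ⟨q, hq, hpq, h2, h3⟩
  · exact ⟨p, hp, hpq.symm, h1, fun d hd h => (h3 d hd h).symm⟩

theorem hole_source {W : Type} {H : SimpleGraph W} {A le : W → W → Prop} (B : BOrd H A le)
    {C : Set W} (hC : HoleSet H C) {s u v : W} (hs : s ∈ C) (hu : u ∈ C) (hv : v ∈ C)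
    (huv : u ≠ v) (su : A s u) (sv : A s v) (hle : le v u) : ∃ a, HD H A le C v s a := by
  have asu : H.Adj s u := (B.adj _ _).2 (Or.inl su)
  have asv : H.Adj s v := (B.adj _ _).2 (Or.inl sv)
  have hnbs : ∀ d ∈ C, H.Adj s d → d = u ∨ d = v := by
    obtain ⟨q, hq, hvq, hsq, h3⟩ := hC.nb' hs hu asu
    rcases h3 v hv asv with h | h
    · exact (huv h.symm).elim
    · subst h; exact h3
  obtain ⟨a, ha, hsa, hva, hnbv⟩ := hC.nb' hv hs asv.symm
  obtain ⟨a', ha', hva', haa', hnba⟩ := hC.nb' ha hv hva.symm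
  have hna : ¬ le v a := B.nadj _ _ hva
  have hau : a ≠ u := by rintro rfl; exact hna hle
  have ha's : a' ≠ s := by
    rintro rfl
    rcases hnbs a ha haa'.symm with h | h
    · exact hau h
    · exact hva.ne' h
  set Z : Set W := {c | c ∈ C ∧ c ≠ s ∧ c ≠ v ∧ c ≠ a ∧ le v c} with hZ
  have huZ : u ∈ Z := ⟨hu, asu.ne', huv, hau.symm, hle⟩
  have hcl : ∀ z ∈ Z, ∀ c ∈ C, c ≠ s → c ≠ v → c ≠ a → H.Adj z c → c ∈ Z := by
    rintro z ⟨hz1, hz2, hz3, hz4, hz5⟩ c hc c1 c2 c3 hzc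
    refine ⟨hc, c1, c2, c3, ?_⟩
    by_contra hn
    rcases B.sep c z v hzc.symm hz5 hn with h | ⟨h, -⟩
    · exact hz3 h
    · rcases hnbv c hc ((B.adj _ _).2 (Or.inr h)) with h | h
      · exact c1 h
      · exact c3 h
  have ha'Z : a' ∈ Z := by
    by_contra hn
    have := hC.conn s hs Z (fun z hz => ⟨hz.1, hz.2.1⟩) ⟨u, huZ⟩ (by
      intro z hz c hc hcs hzc
      by_cases hcv : c = v
      · subst hcv
        rcases hnbv z hz.1 hzc.symm with h | h
        · exact (hz.2.1 h).elim
        · exact (hz.2.2.2.1 h).elim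
      by_cases hca : c = a
      · subst hca
        rcases hnba z hz.1 hzc.symm with h | h
        · exact (hz.2.2.1 h).elim
        · subst h; exact (hn hz).elim
      exact hcl z hz c hc hcs hcv hca hzc) v hv asv.ne'
    exact this.2.2.1 rfl
  have hall : ∀ c ∈ C, c ≠ s → c ∈ Z ∪ {a, v} := by
    refine hC.conn s hs (Z ∪ {a, v}) ?_ ⟨u, Or.inl huZ⟩ ?_
    · rintro z (hz | hz | hz)
      · exact ⟨hz.1, hz.2.1⟩
      · rw [hz]; exact ⟨ha, hsa.symm⟩
      · rw [hz]; exact ⟨hv, asv.ne'⟩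
    · intro z hz c hc hcs hzc
      by_cases hcv : c = v
      · right; right; exact hcv
      by_cases hca : c = a
      · right; left; exact hca
      left
      rcases hz with hz | hz | hz
      · exact hcl z hz c hc hcs hcv hca hzc
      · rw [hz] at hzc
        rcases hnba c hc hzc with h | h
        · exact (hcv h).elim
        · rw [h]; exact ha'Z
      · rw [hz] at hzc
        rcases hnbv c hc hzc with h | h
        · exact (hcs h).elim
        · exact (hca h).elim
  have hA : A a v ∧ A a a' := by
    rcases B.sep a a' v haa' ha'Z.2.2.2.2 hna with h | h
    · exact (hva' h.symm).elim
    · exact h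
  refine ⟨a, hv, hs, ha, hsa, sv, hA.1, hnbv, ?_, ?_, ?_⟩
  · intro c hc h
    rcases hnbs c hc h with h | h <;> rw [h] <;> assumption
  · intro c hc h
    rcases hnba c hc h with h | h <;> rw [h]
    exacts [hA.1, hA.2]
  · intro c hc h1 h2 h3
    rcases hall c hc h1 with h | h | h
    · exact h.2.2.2.2
    · exact (h3 h).elim
    · exact (h2 h).elim

theorem hole_exists {W : Type} {H : SimpleGraph W} {A le : W → W → Prop} (B : BOrd H A le)
    {C : Set W} (hC : HoleSet H C) : ∃ v s a, HD H A le C v s a := by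
  obtain ⟨r, hr⟩ := B.rank
  obtain ⟨s, hs, hmin⟩ : ∃ s ∈ C, ∀ c ∈ C, r s ≤ r c := by
    obtain ⟨c0, hc0⟩ := hC.ne
    have hwf := WellFounded.has_min (measure r).wf C ⟨c0, hc0⟩
    obtain ⟨s, hs, h⟩ := hwf
    exact ⟨s, hs, fun c hc => not_lt.1 (h c hc)⟩
  have hsrc : ∀ c ∈ C, H.Adj s c → A s c := by
    intro c hc h
    rcases (B.adj _ _).1 h with h | h
    · exact h
    · have := hr _ _ h
      have := hmin c hc
      omega
  obtain ⟨u, hu, v, hv, huv, su, sv, -⟩ := hC.nb s hs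
  have h1 := hsrc u hu su
  have h2 := hsrc v hv sv
  rcases B.chain _ _ _ h1 h2 with h | h
  · obtain ⟨a, ha⟩ := hole_source B hC hs hv hu huv.symm h2 h1 h
    exact ⟨_, _, _, ha⟩
  · obtain ⟨a, ha⟩ := hole_source B hC hs hu hv huv h1 h2 h
    exact ⟨_, _, _, ha⟩



/-- An induced subdivision of `K₄` inside `H`, whose edges not at vertex `0` are subdivided. -/
structure K4S {W : Type} (H : SimpleGraph W) (b : Fin 4 → W) (X : Fin 4 → Fin 4 → Set W) :
    Prop where
  inj : ∀ i j, b i = b j → i = j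
  symm : ∀ i j, X i j = X j i
  pp : ∀ i j, i ≠ j → PP H (X i j) (b i) (b j)
  inter : ∀ i j k l, i ≠ j → k ≠ l → ∀ w, w ∈ X i j → w ∈ X k l →
    (i = k ∧ j = l) ∨ (i = l ∧ j = k) ∨ ∃ m, w = b m ∧ (m = i ∨ m = j) ∧ (m = k ∨ m = l)
  edge : ∀ i j k l, i ≠ j → k ≠ l → ∀ u v, u ∈ X i j → v ∈ X k l → H.Adj u v →
    ∃ i' j', i' ≠ j' ∧ u ∈ X i' j' ∧ v ∈ X i' j'
  nadj : ∀ i j, i ≠ 0 → j ≠ 0 → ¬ H.Adj (b i) (b j)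

def Tri {W : Type} (X : Fin 4 → Fin 4 → Set W) (i j k : Fin 4) : Set W :=
  X i j ∪ X j k ∪ X k i

theorem fin4_all : ∀ {i j k l : Fin 4}, i ≠ j → i ≠ k → i ≠ l → j ≠ k → j ≠ l → k ≠ l →
    ∀ m : Fin 4, m = i ∨ m = j ∨ m = k ∨ m = l := by decide

theorem fin4_ex : ∀ {i j k : Fin 4}, i ≠ j → i ≠ k → j ≠ k → ∃ l, i ≠ l ∧ j ≠ l ∧ k ≠ l := by
  decide

namespace K4S
variable {W : Type} {H : SimpleGraph W} {b : Fin 4 → W} {X : Fin 4 → Fin 4 → Set W}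

theorem mem_b (K : K4S H b X) {i j m : Fin 4} (hij : i ≠ j) (h : b m ∈ X i j) : m = i ∨ m = j := by
  obtain ⟨m', hm'⟩ : ∃ m', m ≠ m' := by clear h; revert m; decide
  rcases K.inter i j m m' hij hm' _ h (K.pp m m' hm').left with h1 | h1 | ⟨m'', h1, h2, -⟩
  · exact Or.inl h1.1.symm
  · exact Or.inr h1.2.symm
  · rw [K.inj _ _ h1]; exact h2

theorem inter1 (K : K4S H b X) {i j k : Fin 4} (hij : i ≠ j) (hik : i ≠ k) (hjk : j ≠ k) {w : W}
    (h : w ∈ X i j) (h' : w ∈ X i k) : w = b i := by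
  rcases K.inter i j i k hij hik _ h h' with h1 | h1 | ⟨m, h1, h2, h3⟩
  · exact (hjk h1.2).elim
  · exact (hij h1.2.symm).elim
  · have : m = i := by
      rcases h2 with h2 | h2
      · exact h2
      · rcases h3 with h3 | h3
        · exact h3
        · exact (hjk (h2.symm.trans h3)).elim
    rw [h1, this]

theorem inter0 (K : K4S H b X) {i j k l : Fin 4} (hij : i ≠ j) (hik : i ≠ k) (hil : i ≠ l)
    (hjk : j ≠ k) (hjl : j ≠ l) (hkl : k ≠ l) {w : W}
    (h : w ∈ X i j) (h' : w ∈ X k l) : False := by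
  rcases K.inter i j k l hij hkl _ h h' with h1 | h1 | ⟨m, h1, h2, h3⟩
  · exact (hik h1.1).elim
  · exact (hil h1.1).elim
  · rcases h2 with rfl | rfl <;> rcases h3 with rfl | rfl <;> contradiction

theorem edge6 (K : K4S H b X) {i j k l : Fin 4} (hij : i ≠ j) (hik : i ≠ k) (hil : i ≠ l)
    (hjk : j ≠ k) (hjl : j ≠ l) (hkl : k ≠ l) {p q p' q' : Fin 4} (hp : p ≠ q) (hp' : p' ≠ q')
    {u v : W} (hu : u ∈ X p q) (hv : v ∈ X p' q') (h : H.Adj u v) :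
    (u ∈ X i j ∧ v ∈ X i j) ∨ (u ∈ X i k ∧ v ∈ X i k) ∨ (u ∈ X i l ∧ v ∈ X i l) ∨
    (u ∈ X j k ∧ v ∈ X j k) ∨ (u ∈ X j l ∧ v ∈ X j l) ∨ (u ∈ X k l ∧ v ∈ X k l) := by
  obtain ⟨i', j', h1, h2, h3⟩ := K.edge _ _ _ _ hp hp' u v hu hv h
  have hall := fin4_all hij hik hil hjk hjl hkl
  rcases hall i' with rfl | rfl | rfl | rfl <;> rcases hall j' with rfl | rfl | rfl | rfl <;>
    first
    | exact (h1 rfl).elim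
    | (simp only [h2, h3, true_and, true_or, or_true])
    | (rw [K.symm] at h2 h3; simp only [h2, h3, true_and, true_or, or_true])

theorem tri_mem (X : Fin 4 → Fin 4 → Set W) {i j k : Fin 4} (hij : i ≠ j) (hik : i ≠ k)
    (hjk : j ≠ k) {u : W} (h : u ∈ Tri X i j k) : ∃ p q, p ≠ q ∧ u ∈ X p q := by
  rcases h with (h | h) | h
  exacts [⟨_, _, hij, h⟩, ⟨_, _, hjk, h⟩, ⟨_, _, hik.symm, h⟩]

theorem tri_edge (K : K4S H b X) {i j k : Fin 4} (hij : i ≠ j) (hik : i ≠ k) (hjk : j ≠ k)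
    {u v : W} (hu : u ∈ Tri X i j k) (hv : v ∈ Tri X i j k) (h : H.Adj u v) :
    (u ∈ X i j ∧ v ∈ X i j) ∨ (u ∈ X j k ∧ v ∈ X j k) ∨ (u ∈ X k i ∧ v ∈ X k i) := by
  obtain ⟨l, hil, hjl, hkl⟩ := fin4_ex hij hik hjk
  obtain ⟨p, q, hpq, hu'⟩ := tri_mem X hij hik hjk hu
  obtain ⟨p', q', hpq', hv'⟩ := tri_mem X hij hik hjk hv
  have aux : ∀ m, m = i ∨ m = j ∨ m = k → ∀ w ∈ Tri X i j k, w ∈ X m l → w = b m := by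
    rintro m (rfl | rfl | rfl) w ((hw | hw) | hw) hwl
    · exact K.inter1 hij hil hjl hw hwl
    · exact (K.inter0 hjk hij.symm hjl hik.symm hkl hil hw hwl).elim
    · rw [K.symm] at hw; exact K.inter1 hik hil hkl hw hwl
    · rw [K.symm] at hw; exact K.inter1 hij.symm hjl hil hw hwl
    · exact K.inter1 hjk hjl hkl hw hwl
    · exact (K.inter0 hik.symm hjk.symm hkl hij hil hjl hw hwl).elim
    · exact (K.inter0 hij hik hil hjk hjl hkl hw hwl).elim
    · rw [K.symm] at hw; exact K.inter1 hjk.symm hkl hjl hw hwl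
    · exact K.inter1 hik.symm hkl hil hw hwl
  rcases K.edge6 hij hik hil hjk hjl hkl hpq hpq' hu' hv' h with h1 | h1 | h1 | h1 | h1 | h1
  · exact Or.inl h1
  · rw [K.symm] at h1; exact Or.inr (Or.inr h1)
  · exact (h.ne ((aux i (by simp) u hu h1.1).trans (aux i (by simp) v hv h1.2).symm)).elim
  · exact Or.inr (Or.inl h1)
  · exact (h.ne ((aux j (by simp) u hu h1.1).trans (aux j (by simp) v hv h1.2).symm)).elim
  · exact (h.ne ((aux k (by simp) u hu h1.1).trans (aux k (by simp) v hv h1.2).symm)).elim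

theorem tri_rot (X : Fin 4 → Fin 4 → Set W) (i j k : Fin 4) : Tri X i j k = Tri X j k i := by
  unfold Tri
  ext; simp only [Set.mem_union]; tauto

theorem tri_swap (K : K4S H b X) (i j k : Fin 4) : Tri X i j k = Tri X j i k := by
  unfold Tri
  rw [K.symm i j, K.symm j k, K.symm k i]
  ext; simp only [Set.mem_union]; tauto

theorem tri_nb_b (K : K4S H b X) {i j k : Fin 4} (hij : i ≠ j) (hik : i ≠ k) (hjk : j ≠ k)
    {u v : W} (hu : u ∈ X i j) (hv : v ∈ X i k) (au : H.Adj (b i) u) (av : H.Adj (b i) v)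
    (uu : ∀ d ∈ X i j, H.Adj (b i) d → d = u) (uv : ∀ d ∈ X i k, H.Adj (b i) d → d = v) :
    u ≠ v ∧ ∀ d ∈ Tri X i j k, H.Adj (b i) d → d = u ∨ d = v := by
  refine ⟨?_, ?_⟩
  · rintro rfl
    exact au.ne' (K.inter1 hij hik hjk hu hv)
  · intro d hd h
    rcases K.tri_edge hij hik hjk (Or.inl (Or.inl (K.pp i j hij).left)) hd h with h1 | h1 | h1
    · exact Or.inl (uu d h1.2 h)
    · rcases K.mem_b hjk h1.1 with h2 | h2
      · exact (hij h2).elim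
      · exact (hik h2).elim
    · rw [K.symm k i] at h1
      exact Or.inr (uv d h1.2 h)

theorem tri_nb_aux (K : K4S H b X) {i j k : Fin 4} (hij : i ≠ j) (hik : i ≠ k) (hjk : j ≠ k) :
    ∃ u ∈ Tri X i j k, ∃ v ∈ Tri X i j k, u ≠ v ∧ H.Adj (b i) u ∧ H.Adj (b i) v ∧
      ∀ d ∈ Tri X i j k, H.Adj (b i) d → d = u ∨ d = v := by
  obtain ⟨u, hu, au, uu⟩ := (K.pp i j hij).end_nbr
  obtain ⟨v, hv, av, uv⟩ := (K.pp i k hik).end_nbr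
  obtain ⟨h1, h2⟩ := K.tri_nb_b hij hik hjk hu hv au av uu uv
  refine ⟨u, Or.inl (Or.inl hu), v, Or.inr (by rw [K.symm]; exact hv), h1, au, av, h2⟩

theorem tri_nb_aux2 (K : K4S H b X) {i j k : Fin 4} (hij : i ≠ j) (hik : i ≠ k) (hjk : j ≠ k)
    {s : W} (hs : s ∈ X i j) :
    ∃ u ∈ Tri X i j k, ∃ v ∈ Tri X i j k, u ≠ v ∧ H.Adj s u ∧ H.Adj s v ∧
      ∀ d ∈ Tri X i j k, H.Adj s d → d = u ∨ d = v := by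
  by_cases h1 : s = b i
  · subst h1; exact K.tri_nb_aux hij hik hjk
  by_cases h2 : s = b j
  · subst h2
    rw [K.tri_swap]
    exact K.tri_nb_aux hij.symm hjk hik
  obtain ⟨u, hu, v, hv, huv, su, sv, h⟩ := (K.pp i j hij).int_nbr hs h1 h2
  refine ⟨u, Or.inl (Or.inl hu), v, Or.inl (Or.inl hv), huv, su, sv, ?_⟩
  intro d hd hsd
  rcases K.tri_edge hij hik hjk (Or.inl (Or.inl hs)) hd hsd with h3 | h3 | h3
  · exact h d h3.2 hsd
  · rw [K.symm] at hs; exact (h2 (K.inter1 hij.symm hjk hik hs h3.1)).elim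
  · rw [K.symm k i] at h3; exact (h1 (K.inter1 hij hik hjk hs h3.1)).elim

theorem tri_conn_aux (K : K4S H b X) {i j k : Fin 4} (hij : i ≠ j) (hik : i ≠ k) (hjk : j ≠ k)
    {s : W} (hs : s ∈ X i j) (Z : Set W) (hZs : ∀ z ∈ Z, z ∈ Tri X i j k ∧ z ≠ s) (hZ : Z.Nonempty)
    (hcl : ∀ z ∈ Z, ∀ c ∈ Tri X i j k, c ≠ s → H.Adj z c → c ∈ Z) :
    ∀ c ∈ Tri X i j k, c ≠ s → c ∈ Z := by
  obtain ⟨t, ht⟩ := hZ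
  obtain ⟨htT, hts⟩ := hZs t ht
  have c1 : ∀ z ∈ Z, z ∈ X i j → ∀ c ∈ X i j, c ≠ s → H.Adj z c → c ∈ Z :=
    fun z hz _ c hc => hcl z hz c (Or.inl (Or.inl hc))
  have c2 : ∀ z ∈ Z, z ∈ X j k → ∀ c ∈ X j k, c ≠ s → H.Adj z c → c ∈ Z :=
    fun z hz _ c hc => hcl z hz c (Or.inl (Or.inr hc))
  have c3 : ∀ z ∈ Z, z ∈ X k i → ∀ c ∈ X k i, c ≠ s → H.Adj z c → c ∈ Z :=
    fun z hz _ c hc => hcl z hz c (Or.inr hc)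
  have p1 := K.pp i j hij
  have p2 := K.pp j k hjk
  have p3 := K.pp k i hik.symm
  have n2 : s ∈ X j k → s = b j := fun h => by
    rw [K.symm] at hs; exact K.inter1 hij.symm hjk hik hs h
  have n3 : s ∈ X k i → s = b i := fun h => by
    rw [K.symm] at h; exact K.inter1 hij hik hjk hs h
  -- transmission along pieces avoiding s
  have t2 : s ≠ b j → ∀ z ∈ Z, z ∈ X j k → ∀ c ∈ X j k, H.Adj z c → c ∈ Z :=
    fun h z hz hz' c hc => c2 z hz hz' c hc (by rintro rfl; exact h (n2 hc))
  have t3 : s ≠ b i → ∀ z ∈ Z, z ∈ X k i → ∀ c ∈ X k i, H.Adj z c → c ∈ Z :=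
    fun h z hz hz' c hc => c3 z hz hz' c hc (by rintro rfl; exact h (n3 hc))
  have bij : b i ≠ b j := fun h => hij (K.inj _ _ h)
  have bik : b i ≠ b k := fun h => hik (K.inj _ _ h)
  have bjk : b j ≠ b k := fun h => hjk (K.inj _ _ h)
  have hsk : s ≠ b k := by
    rintro rfl
    rcases K.mem_b hij hs with h | h
    · exact hik h.symm
    · exact hjk h.symm
  have e1 : t ∈ X i j → b i ∈ Z ∨ b j ∈ Z := fun h => p1.spread_out c1 h ht hts
  have e2 : t ∈ X j k → b j ∈ Z ∨ b k ∈ Z := fun h => p2.spread_out c2 h ht hts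
  have e3 : t ∈ X k i → b k ∈ Z ∨ b i ∈ Z := fun h => p3.spread_out c3 h ht hts
  have hsZ : s ∉ Z := fun h => (hZs s h).2 rfl
  have e : b i ∈ Z ∨ b j ∈ Z ∨ b k ∈ Z := by
    rcases htT with (h | h) | h
    · exact (e1 h).elim Or.inl (fun h => Or.inr (Or.inl h))
    · exact Or.inr (e2 h)
    · exact (e3 h).elim (fun h => Or.inr (Or.inr h)) Or.inl
  have jk : s ≠ b j → (b j ∈ Z ↔ b k ∈ Z) := fun h =>
    ⟨fun h' => p2.spread_all (t2 h) h' _ p2.right, fun h' => p2.symm.spread_all (t2 h) h' _ p2.left⟩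
  have ki : s ≠ b i → (b k ∈ Z ↔ b i ∈ Z) := fun h =>
    ⟨fun h' => p3.spread_all (t3 h) h' _ p3.right, fun h' => p3.symm.spread_all (t3 h) h' _ p3.left⟩
  have fin : (b i ∈ Z ∨ b i = s) ∧ (b j ∈ Z ∨ b j = s) ∧ (b k ∈ Z ∨ b k = s) := by
    by_cases h1 : s = b i
    · have hj : s ≠ b j := by rw [h1]; exact bij
      have hi : b i ∉ Z := by rw [← h1]; exact hsZ
      have hk : b k ∈ Z := e.elim (fun h => (hi h).elim) (fun h => h.elim (jk hj).1 id)
      exact ⟨Or.inr h1.symm, Or.inl ((jk hj).2 hk), Or.inl hk⟩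
    · by_cases h2 : s = b j
      · have hi : b j ∉ Z := by rw [← h2]; exact hsZ
        have hk : b k ∈ Z := e.elim (ki h1).2 (fun h => h.elim (fun h => (hi h).elim) id)
        exact ⟨Or.inl ((ki h1).1 hk), Or.inr h2.symm, Or.inl hk⟩
      · have hk : b k ∈ Z := e.elim (ki h1).2 (fun h => h.elim (jk h2).1 id)
        exact ⟨Or.inl ((ki h1).1 hk), Or.inl ((jk h2).2 hk), Or.inl hk⟩
  obtain ⟨f1, f2, f3⟩ := fin
  rintro c ((hc | hc) | hc) hcs
  · exact p1.spread_in c1 f1 f2 c hc hcs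
  · exact p2.spread_in c2 f2 f3 c hc hcs
  · exact p3.spread_in c3 f3 f1 c hc hcs

theorem tri_hole (K : K4S H b X) {i j k : Fin 4} (hij : i ≠ j) (hik : i ≠ k) (hjk : j ≠ k) :
    HoleSet H (Tri X i j k) := by
  refine ⟨⟨b i, Or.inl (Or.inl (K.pp i j hij).left)⟩, ?_, ?_⟩
  · rintro s ((hs | hs) | hs)
    · exact K.tri_nb_aux2 hij hik hjk hs
    · rw [tri_rot]; exact K.tri_nb_aux2 hjk hij.symm hik.symm hs
    · rw [← tri_rot]; exact K.tri_nb_aux2 hik.symm hjk.symm hij hs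
  · rintro s ((hs | hs) | hs)
    · exact K.tri_conn_aux hij hik hjk hs
    · rw [tri_rot]; exact K.tri_conn_aux hjk hij.symm hik.symm hs
    · rw [← tri_rot]; exact K.tri_conn_aux hik.symm hjk.symm hij hs

end K4S


section up
variable {W : Type} {H : SimpleGraph W} {A le : W → W → Prop}

theorem up_all (B : BOrd H A le) {X : Set W} {a b v : W} (p : PP H X a b)
    (ha : le v a ∧ a ≠ v) (h : ∀ d ∈ X, d ≠ v ∧ ¬ A d v) : ∀ t ∈ X, le v t ∧ t ≠ v := by
  refine p.spread_all (Z := {c | le v c ∧ c ≠ v}) ?_ ha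
  rintro z ⟨hz1, hz2⟩ - c hc hzc
  refine ⟨?_, (h c hc).1⟩
  by_contra hn
  rcases B.sep c z v hzc.symm hz1 hn with h1 | h1
  · exact hz2 h1
  · exact (h c hc).2 h1.1

theorem up_but (B : BOrd H A le) {X : Set W} {a b v : W} (p : PP H X a b)
    (ha : le v a ∧ a ≠ v) (h : ∀ d ∈ X, d ≠ b → d ≠ v ∧ ¬ A d v) :
    ∀ t ∈ X, t ≠ b → le v t ∧ t ≠ v := by
  refine p.spread_but (Z := {c | le v c ∧ c ≠ v}) ?_ ha
  rintro z ⟨hz1, hz2⟩ - c hc hcb hzc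
  refine ⟨?_, (h c hc hcb).1⟩
  by_contra hn
  rcases B.sep c z v hzc.symm hz1 hn with h1 | h1
  · exact hz2 h1
  · exact (h c hc hcb).2 h1.1

end up

namespace K4S
variable {W : Type} {H : SimpleGraph W} {b : Fin 4 → W} {X : Fin 4 → Fin 4 → Set W}
  {A le : W → W → Prop}

theorem sink_aux1 (K : K4S H b X) (B : BOrd H A le) (n : Fin 4 → W)
    (hn : ∀ j, j ≠ 0 → n j ∈ X 0 j ∧ H.Adj (b 0) (n j) ∧ ∀ d ∈ X 0 j, H.Adj (b 0) d → d = n j)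
    (hp : ∀ j k, j ≠ 0 → k ≠ 0 → j ≠ k → ∃ s a, HD H A le (Tri X 0 j k) (b 0) s a)
    {j k l : Fin 4} (hj : j ≠ 0) (hk : k ≠ 0) (hl : l ≠ 0) (hjk : j ≠ k) (hjl : j ≠ l)
    (hkl : k ≠ l) {v s a : W} (hD : HD H A le (Tri X j k l) v s a) (hv : v ∈ X j k) :
    le (b 0) v := by
  obtain ⟨s', a', hD'⟩ := hp j k hj hk hjk
  obtain ⟨hnj, anj, unj⟩ := hn j hj
  obtain ⟨hnk, ank, unk⟩ := hn k hk
  obtain ⟨hne, hN⟩ := K.tri_nb_b hj.symm hk.symm hjk hnj hnk anj ank unj unk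
  have hs' := hN s' hD'.hs ((B.adj _ _).2 (Or.inr hD'.sv))
  have ha' := hN a' hD'.ha ((B.adj _ _).2 (Or.inr hD'.av))
  have hnjs := hD'.nbv (n j) (Or.inl (Or.inl hnj)) anj
  have hnks := hD'.nbv (n k) (Or.inr (by rw [K.symm]; exact hnk)) ank
  have hv0 : v ≠ b 0 := by
    rintro rfl
    rcases K.mem_b hjk hv with h | h
    · exact hj h.symm
    · exact hk h.symm
  have hvT : v ∈ Tri X 0 j k := Or.inl (Or.inr hv)
  have hsrc : ∀ w, w = n j ∨ w = n k → ∀ c ∈ Tri X 0 j k, H.Adj w c → A w c := by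
    intro w hw c hc hwc
    have : w = s' ∨ w = a' := by
      rcases hw with rfl | rfl
      · exact hnjs
      · exact hnks
    rcases this with rfl | rfl
    · exact hD'.srcs c hc hwc
    · exact hD'.srca c hc hwc
  have hno : ∀ c ∈ X j k, H.Adj v c → ¬ A v c := by
    intro c hc hvc
    apply B.asymm
    rcases hD.nbv c (Or.inl (Or.inl hc)) hvc with rfl | rfl
    · exact hD.sv
    · exact hD.av
  have hvj : v ≠ n j := by
    intro h
    have hb : v = b j := by
      rw [← h, K.symm] at hnj
      exact K.inter1 hj hjk hk.symm hnj hv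
    obtain ⟨c, hc, hac, -⟩ := (K.pp j k hjk).end_nbr
    rw [← hb] at hac
    exact hno c hc hac (hsrc v (Or.inl h) c (Or.inl (Or.inr hc)) hac)
  have hvk : v ≠ n k := by
    intro h
    have hb : v = b k := by
      rw [← h, K.symm] at hnk
      rw [K.symm] at hv
      exact K.inter1 hk hjk.symm hj.symm hnk hv
    obtain ⟨c, hc, hac, -⟩ := (K.pp j k hjk).symm.end_nbr
    rw [← hb] at hac
    exact hno c hc hac (hsrc v (Or.inr h) c (Or.inl (Or.inr hc)) hac)
  refine hD'.sub v hvT ?_ hv0 ?_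
  · rintro rfl
    rcases hs' with h | h
    · exact hvj h
    · exact hvk h
  · rintro rfl
    rcases ha' with h | h
    · exact hvj h
    · exact hvk h

theorem sink_aux2 (K : K4S H b X) (B : BOrd H A le)
    {j k l : Fin 4} (hj : j ≠ 0) (hk : k ≠ 0) (hl : l ≠ 0) (hjk : j ≠ k) (hjl : j ≠ l)
    (hkl : k ≠ l) {v s a : W} (hD : HD H A le (Tri X j k l) v s a) (hle : le (b 0) v)
    (hs : b j ≠ s) (hv : b j ≠ v) (ha : b j ≠ a) : False := by
  have hjT : b j ∈ Tri X j k l := Or.inl (Or.inl (K.pp j k hjk).left)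
  have h1 := hD.sub (b j) hjT hs hv ha
  have hvj0 : v ∉ X j 0 := by
    intro h
    apply hv
    symm
    rcases hD.hv with (h2 | h2) | h2
    · exact K.inter1 hjk hj hk h2 h
    · exact (K.inter0 hkl hjk.symm hk hjl.symm hl hj h2 h).elim
    · rw [K.symm] at h2; exact K.inter1 hjl hj hl h2 h
  have hnb : ¬ H.Adj (b j) v := by
    intro h
    rcases hD.nbv (b j) hjT h.symm with h | h
    · exact hs h
    · exact ha h
  obtain ⟨p, q, hpq, hvpq⟩ := tri_mem X hjk hjl hkl hD.hv
  have h2 := up_all B (K.pp j 0 hj) (v := v) ⟨h1, hv⟩ (by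
    intro d hd
    refine ⟨by rintro rfl; exact hvj0 hd, fun hA => ?_⟩
    have hadj : H.Adj d v := (B.adj _ _).2 (Or.inl hA)
    have h0 : d ≠ b 0 := by rintro rfl; exact B.nadj _ _ hadj hle
    rcases K.edge6 hjk hjl hj hkl hk hl hj hpq hd hvpq hadj with h | h | h | h | h | h
    · rw [K.inter1 hjk hj hk h.1 hd] at hadj; exact hnb hadj
    · rw [K.inter1 hjl hj hl h.1 hd] at hadj; exact hnb hadj
    · exact hvj0 h.2
    · exact K.inter0 hkl hjk.symm hk hjl.symm hl hj h.1 hd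
    · rw [K.symm] at hd h; exact h0 (K.inter1 hk.symm hj.symm hjk.symm h.1 hd)
    · rw [K.symm] at hd h; exact h0 (K.inter1 hl.symm hj.symm hjl.symm h.1 hd)) (b 0)
      (K.pp j 0 hj).right
  exact h2.2 (B.antisymm _ _ hle h2.1)

theorem sink_case (K : K4S H b X) (B : BOrd H A le) (n : Fin 4 → W)
    (hn : ∀ j, j ≠ 0 → n j ∈ X 0 j ∧ H.Adj (b 0) (n j) ∧ ∀ d ∈ X 0 j, H.Adj (b 0) d → d = n j)
    (hp : ∀ j k, j ≠ 0 → k ≠ 0 → j ≠ k → ∃ s a, HD H A le (Tri X 0 j k) (b 0) s a) : False := by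
  have h10 : (1 : Fin 4) ≠ 0 := by decide
  have h20 : (2 : Fin 4) ≠ 0 := by decide
  have h30 : (3 : Fin 4) ≠ 0 := by decide
  have h12 : (1 : Fin 4) ≠ 2 := by decide
  have h13 : (1 : Fin 4) ≠ 3 := by decide
  have h23 : (2 : Fin 4) ≠ 3 := by decide
  obtain ⟨v, s, a, hD⟩ := hole_exists B (K.tri_hole h12 h13 h23)
  have hD2 : HD H A le (Tri X 2 3 1) v s a := by rw [← tri_rot]; exact hD
  have hD3 : HD H A le (Tri X 3 1 2) v s a := by rw [← tri_rot]; exact hD2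
  have hle : le (b 0) v := by
    rcases hD.hv with (h | h) | h
    · exact K.sink_aux1 B n hn hp h10 h20 h30 h12 h13 h23 hD h
    · exact K.sink_aux1 B n hn hp h20 h30 h10 h23 h12.symm h13.symm hD2 h
    · exact K.sink_aux1 B n hn hp h30 h10 h20 h13.symm h23.symm h12 hD3 h
  have e1 : b 1 = s ∨ b 1 = v ∨ b 1 = a := by
    by_contra! h
    exact K.sink_aux2 B h10 h20 h30 h12 h13 h23 hD hle h.1 h.2.1 h.2.2
  have e2 : b 2 = s ∨ b 2 = v ∨ b 2 = a := by
    by_contra! h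
    exact K.sink_aux2 B h20 h30 h10 h23 h12.symm h13.symm hD2 hle h.1 h.2.1 h.2.2
  have e3 : b 3 = s ∨ b 3 = v ∨ b 3 = a := by
    by_contra! h
    exact K.sink_aux2 B h30 h10 h20 h13.symm h23.symm h12 hD3 hle h.1 h.2.1 h.2.2
  have i12 : b 1 ≠ b 2 := fun h => h12 (K.inj _ _ h)
  have i13 : b 1 ≠ b 3 := fun h => h13 (K.inj _ _ h)
  have i23 : b 2 ≠ b 3 := fun h => h23 (K.inj _ _ h)
  have asv : H.Adj s v := (B.adj _ _).2 (Or.inl hD.sv)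
  have aav : H.Adj a v := (B.adj _ _).2 (Or.inl hD.av)
  have n12 := K.nadj 1 2 h10 h20
  have n13 := K.nadj 1 3 h10 h30
  have n23 := K.nadj 2 3 h20 h30
  have n21 := K.nadj 2 1 h20 h10
  have n31 := K.nadj 3 1 h30 h10
  have n32 := K.nadj 3 2 h30 h20
  rcases e1 with e1 | e1 | e1 <;> rcases e2 with e2 | e2 | e2 <;>
    rcases e3 with e3 | e3 | e3 <;> rw [e1] at i12 i13 n12 n13 n21 n31 <;>
    rw [e2] at i12 i23 n12 n21 n23 n32 <;> rw [e3] at i13 i23 n13 n31 n23 n32 <;>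
    first | exact i12 rfl | exact i13 rfl | exact i23 rfl | exact n12 asv | exact n12 aav |
      exact n21 asv | exact n21 aav | exact n13 asv | exact n13 aav

theorem source_aux (K : K4S H b X) (B : BOrd H A le) (n : Fin 4 → W)
    (hn : ∀ j, j ≠ 0 → n j ∈ X 0 j ∧ H.Adj (b 0) (n j) ∧ ∀ d ∈ X 0 j, H.Adj (b 0) d → d = n j)
    (hA : ∀ j, j ≠ 0 → A (b 0) (n j))
    {j k l : Fin 4} (hj : j ≠ 0) (hk : k ≠ 0) (hl : l ≠ 0) (hjk : j ≠ k) (hjl : j ≠ l)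
    (hkl : k ≠ l) (h1 : le (n j) (n k)) (h2 : le (n k) (n l)) : False := by
  obtain ⟨hnj, anj, unj⟩ := hn j hj
  obtain ⟨hnk, ank, unk⟩ := hn k hk
  obtain ⟨hnl, anl, unl⟩ := hn l hl
  have hjk' : n j ≠ n k := by
    intro h
    rw [← h] at hnk
    exact anj.ne' (K.inter1 hj.symm hk.symm hjk hnj hnk)
  have hkl' : n k ≠ n l := by
    intro h
    rw [← h] at hnl
    exact ank.ne' (K.inter1 hk.symm hl.symm hkl hnk hnl)
  obtain ⟨a, hD⟩ := hole_source B (K.tri_hole hk.symm hl.symm hkl) (s := b 0) (u := n l) (v := n k)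
    (Or.inl (Or.inl (K.pp 0 k hk.symm).left)) (Or.inr (by rw [K.symm]; exact hnl))
    (Or.inl (Or.inl hnk)) hkl'.symm (hA l hl) (hA k hk) h2
  have hN : ∀ d p q, p ≠ q → d ∈ X p q → H.Adj d (n k) →
      d ∈ X 0 k ∨ (n k = b k ∧ (d ∈ X j k ∨ d ∈ X k l)) := by
    intro d p q hpq hd hadj
    rcases K.edge6 hj.symm hk.symm hl.symm hjk hjl hkl hpq hk.symm hd hnk hadj with
      h | h | h | h | h | h
    · exact (ank.ne' (K.inter1 hk.symm hj.symm hjk.symm hnk h.2)).elim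
    · exact Or.inl h.1
    · exact (ank.ne' (K.inter1 hk.symm hl.symm hkl hnk h.2)).elim
    · right
      refine ⟨?_, Or.inl h.1⟩
      rw [K.symm] at hnk h
      exact K.inter1 hk hjk.symm hj.symm hnk h.2
    · exact (K.inter0 hk.symm hj.symm hl.symm hjk.symm hkl hjl hnk h.2).elim
    · right
      refine ⟨?_, Or.inr h.1⟩
      rw [K.symm] at hnk
      exact K.inter1 hk hkl hl.symm hnk h.2
  have nbl : ¬ H.Adj (b l) (n k) := by
    intro h
    rcases hN (b l) l j hjl.symm (K.pp l j hjl.symm).left h with h3 | ⟨h3, h4⟩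
    · rcases K.mem_b hk.symm h3 with h4 | h4
      · exact hl h4
      · exact hkl h4.symm
    · rw [h3] at h; exact K.nadj _ _ hl hk h
  have nbj : ¬ H.Adj (b j) (n k) := by
    intro h
    rcases hN (b j) j l hjl (K.pp j l hjl).left h with h3 | ⟨h3, h4⟩
    · rcases K.mem_b hk.symm h3 with h4 | h4
      · exact hj h4
      · exact hjk h4
    · rw [h3] at h; exact K.nadj _ _ hj hk h
  have hblk : b l ≠ n k := by
    intro h
    rw [← h] at hnk
    rcases K.mem_b hk.symm hnk with h4 | h4
    · exact hl h4
    · exact hkl h4.symm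
  have g1 : le (n k) (b l) := by
    refine hD.sub (b l) (Or.inl (Or.inr (K.pp k l hkl).right)) ?_ hblk ?_
    · intro h; exact hl (K.inj _ _ h)
    · rintro rfl
      exact nbl ((B.adj _ _).2 (Or.inl hD.av))
  have g2 := up_all B (K.pp l j hjl.symm) (v := n k) ⟨g1, hblk⟩ (by
    intro d hd
    refine ⟨?_, fun h => ?_⟩
    · rintro rfl
      exact K.inter0 hk.symm hl.symm hj.symm hkl hjk.symm hjl.symm hnk hd
    · have hadj : H.Adj d (n k) := (B.adj _ _).2 (Or.inl h)
      rcases hN d l j hjl.symm hd hadj with h3 | ⟨h3, h4 | h4⟩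
      · exact K.inter0 hk.symm hl.symm hj.symm hkl hjk.symm hjl.symm h3 hd
      · rw [K.symm] at hd
        rw [K.inter1 hjk hjl hkl h4 hd] at hadj
        exact nbj hadj
      · rw [K.symm] at h4
        rw [K.inter1 hkl.symm hjl.symm hjk.symm h4 hd] at hadj
        exact nbl hadj) (b j) (K.pp l j hjl.symm).right
  have g3 := up_but B (K.pp j 0 hj) (v := n k) g2 (by
    intro d hd hd0
    rw [K.symm] at hd
    refine ⟨?_, fun h => ?_⟩
    · rintro rfl
      exact hd0 (K.inter1 hj.symm hk.symm hjk hd hnk)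
    · have hadj : H.Adj d (n k) := (B.adj _ _).2 (Or.inl h)
      rcases hN d 0 j hj.symm hd hadj with h3 | ⟨h3, h4 | h4⟩
      · exact hd0 (K.inter1 hj.symm hk.symm hjk hd h3)
      · rw [K.symm] at hd
        rw [K.inter1 hjk hj hk h4 hd] at hadj
        exact nbj hadj
      · exact K.inter0 hj.symm hk.symm hl.symm hjk hjl hkl hd h4) (n j)
        (by rw [K.symm]; exact hnj) anj.ne'
  exact hjk' (B.antisymm _ _ h1 g3.1)

theorem main (K : K4S H b X) (B : BOrd H A le) :
    ∃ j k v s a, j ≠ 0 ∧ k ≠ 0 ∧ j ≠ k ∧ HD H A le (Tri X 0 j k) v s a ∧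
      b 0 ≠ s ∧ b 0 ≠ v ∧ b 0 ≠ a := by
  by_contra hcon
  push Not at hcon
  have hn' : ∀ j, ∃ c, j ≠ 0 → c ∈ X 0 j ∧ H.Adj (b 0) c ∧ ∀ d ∈ X 0 j, H.Adj (b 0) d → d = c := by
    intro j
    by_cases hj : j = 0
    · exact ⟨b 0, fun h => (h hj).elim⟩
    · obtain ⟨c, h1, h2, h3⟩ := (K.pp 0 j (Ne.symm hj)).end_nbr
      exact ⟨c, fun _ => ⟨h1, h2, h3⟩⟩
  choose n hn using hn'
  have h10 : (1 : Fin 4) ≠ 0 := by decide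
  have h20 : (2 : Fin 4) ≠ 0 := by decide
  have h30 : (3 : Fin 4) ≠ 0 := by decide
  have h12 : (1 : Fin 4) ≠ 2 := by decide
  have h13 : (1 : Fin 4) ≠ 3 := by decide
  have h23 : (2 : Fin 4) ≠ 3 := by decide
  have dich : ∀ j k, j ≠ 0 → k ≠ 0 → j ≠ k →
      ((∃ s a, HD H A le (Tri X 0 j k) (b 0) s a) ∧ A (n j) (b 0) ∧ A (n k) (b 0)) ∨
      (A (b 0) (n j) ∧ A (b 0) (n k)) := by
    intro j k hj hk hjk
    obtain ⟨hnj, anj, unj⟩ := hn j hj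
    obtain ⟨hnk, ank, unk⟩ := hn k hk
    have mj : n j ∈ Tri X 0 j k := Or.inl (Or.inl hnj)
    have mk : n k ∈ Tri X 0 j k := Or.inr (by rw [K.symm]; exact hnk)
    obtain ⟨v, s, a, hD⟩ := hole_exists B (K.tri_hole hj.symm hk.symm hjk)
    by_cases h1 : b 0 = s
    · subst h1
      exact Or.inr ⟨hD.srcs _ mj anj, hD.srcs _ mk ank⟩
    by_cases h2 : b 0 = v
    · subst h2
      have : ∀ w ∈ Tri X 0 j k, H.Adj (b 0) w → A w (b 0) := by
        intro w hw h
        rcases hD.nbv w hw h with rfl | rfl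
        · exact hD.sv
        · exact hD.av
      exact Or.inl ⟨⟨s, a, hD⟩, this _ mj anj, this _ mk ank⟩
    have h3 := hcon j k v s a hj hk hjk hD h1 h2
    subst h3
    exact Or.inr ⟨hD.srca _ mj anj, hD.srca _ mk ank⟩
  by_cases hA1 : A (b 0) (n 1)
  · have hA : ∀ j, j ≠ 0 → A (b 0) (n j) := by
      intro j hj
      by_cases hj1 : j = 1
      · rw [hj1]; exact hA1
      · rcases dich 1 j h10 hj (Ne.symm hj1) with h | h
        · exact (B.asymm _ _ hA1 h.2.1).elim
        · exact h.2
    have key := fun {j k l : Fin 4} => K.source_aux B n hn hA (j := j) (k := k) (l := l)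
    rcases B.chain _ _ _ (hA 1 h10) (hA 2 h20) with a12 | a12 <;>
    rcases B.chain _ _ _ (hA 2 h20) (hA 3 h30) with a23 | a23 <;>
    rcases B.chain _ _ _ (hA 1 h10) (hA 3 h30) with a13 | a13
    · exact key h10 h20 h30 h12 h13 h23 a12 a23
    · exact key h10 h20 h30 h12 h13 h23 a12 a23
    · exact key h10 h30 h20 h13 h12 h23.symm a13 a23
    · exact key h30 h10 h20 h13.symm h23.symm h12 a13 a12
    · exact key h20 h10 h30 h12.symm h23 h13 a12 a13
    · exact key h20 h30 h10 h23 h12.symm h13.symm a23 a13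
    · exact key h30 h20 h10 h23.symm h13.symm h12.symm a23 a12
    · exact key h30 h20 h10 h23.symm h13.symm h12.symm a23 a12
  · have hA : ∀ j, j ≠ 0 → ¬ A (b 0) (n j) := by
      intro j hj
      by_cases hj1 : j = 1
      · rw [hj1]; exact hA1
      · rcases dich 1 j h10 hj (Ne.symm hj1) with h | h
        · exact B.asymm _ _ h.2.2
        · exact (hA1 h.1).elim
    refine K.sink_case B n hn ?_
    intro j k hj hk hjk
    rcases dich j k hj hk hjk with h | h
    · exact h.1
    · exact (hA j hj h.1).elim

end K4S


/-- Construct a `K4S` from a looser family of sets. -/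
theorem K4S.of_sets {W : Type} {H : SimpleGraph W} {b : Fin 4 → W} {S : Fin 4 → Fin 4 → Set W}
    (hinj : ∀ i j, b i = b j → i = j) (hsymm : ∀ i j, S i j = S j i)
    (hpp : ∀ i j, i < j → ∃ X, X ⊆ S i j ∧ PP H X (b i) (b j))
    (hinter : ∀ i j k l, i ≠ j → k ≠ l → ∀ w, w ∈ S i j → w ∈ S k l →
      (i = k ∧ j = l) ∨ (i = l ∧ j = k) ∨ ∃ m, w = b m ∧ (m = i ∨ m = j) ∧ (m = k ∨ m = l))
    (hedge : ∀ i j k l, i ≠ j → k ≠ l → ∀ u v, u ∈ S i j → v ∈ S k l → H.Adj u v →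
      ∃ i' j', i' ≠ j' ∧ u ∈ S i' j' ∧ v ∈ S i' j')
    (hnadj : ∀ i j, i ≠ 0 → j ≠ 0 → ¬ H.Adj (b i) (b j)) :
    ∃ X, K4S H b X ∧ ∀ i j, i ≠ j → X i j ⊆ S i j := by
  have h1 : ∀ i j, ∃ X, i < j → X ⊆ S i j ∧ PP H X (b i) (b j) := by
    intro i j
    by_cases h : i < j
    · obtain ⟨X, hX⟩ := hpp i j h
      exact ⟨X, fun _ => hX⟩
    · exact ⟨∅, fun h' => absurd h' h⟩
  choose Y hY using h1
  obtain ⟨X, hX⟩ : ∃ X : Fin 4 → Fin 4 → Set W, X = fun i j => if i < j then Y i j else Y j i :=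
    ⟨_, rfl⟩
  have hXs : ∀ i j, X i j = X j i := by
    intro i j
    subst hX
    dsimp only
    rcases lt_trichotomy i j with h | h | h
    · rw [if_pos h, if_neg (not_lt.2 h.le)]
    · subst h; rfl
    · rw [if_pos h, if_neg (not_lt.2 h.le)]
  have hXlt : ∀ i j, i < j → X i j = Y i j := by
    intro i j h
    subst hX
    dsimp only
    rw [if_pos h]
  have hsub : ∀ i j, i ≠ j → X i j ⊆ S i j := by
    intro i j h
    rcases lt_or_gt_of_ne h with h | h
    · rw [hXlt _ _ h]; exact (hY i j h).1
    · rw [hXs, hXlt _ _ h, hsymm]; exact (hY j i h).1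
  have hP : ∀ i j, i ≠ j → PP H (X i j) (b i) (b j) := by
    intro i j h
    rcases lt_or_gt_of_ne h with h | h
    · rw [hXlt _ _ h]; exact (hY i j h).2
    · rw [hXs, hXlt _ _ h]; exact (hY j i h).2.symm
  have key : ∀ i j k l, i ≠ j → k ≠ l → ∀ u, u ∈ X i j → u ∈ S k l → u ∈ X k l := by
    intro i j k l hij hkl u hu hu'
    rcases hinter i j k l hij hkl u (hsub _ _ hij hu) hu' with ⟨rfl, rfl⟩ | ⟨rfl, rfl⟩ | ⟨m, rfl, -, rfl | rfl⟩
    · exact hu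
    · rwa [hXs]
    · exact (hP _ _ hkl).left
    · exact (hP _ _ hkl).right
  refine ⟨X, ⟨hinj, hXs, hP, ?_, ?_, hnadj⟩, hsub⟩
  · intro i j k l hij hkl w hw hw'
    exact hinter i j k l hij hkl w (hsub _ _ hij hw) (hsub _ _ hkl hw')
  · intro i j k l hij hkl u v hu hv huv
    obtain ⟨i', j', h, h1, h2⟩ := hedge i j k l hij hkl u v (hsub _ _ hij hu) (hsub _ _ hkl hv) huv
    exact ⟨i', j', h, key i j i' j' hij h u hu h1, key k l i' j' hkl h v hv h2⟩

section subdiv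
variable {V W : Type} {D : SimpleGraph V} {D' : SimpleGraph W} {f : V ↪ W}
  {P : ∀ ⦃u v : V⦄, D.Adj u v → D'.Walk (f u) (f v)}

/-- Vertices of the subdivision lying on (a path of) an edge from `E`. -/
def SE (P : ∀ ⦃u v : V⦄, D.Adj u v → D'.Walk (f u) (f v)) (E : Set (Sym2 V)) : Set W :=
  {w | ∃ u v, ∃ h : D.Adj u v, s(u, v) ∈ E ∧ w ∈ (P h).support}

theorem SE_mono {E E' : Set (Sym2 V)} (h : E ⊆ E') : SE P E ⊆ SE P E' := by
  rintro w ⟨u, v, ha, he, hw⟩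
  exact ⟨u, v, ha, h he, hw⟩

theorem SE_inter (hs : IsSubdivisionVia D' D f P) {E E' : Set (Sym2 V)} {w : W}
    (h : w ∈ SE P E) (h' : w ∈ SE P E') :
    (∃ u v, u ≠ v ∧ s(u, v) ∈ E ∧ s(u, v) ∈ E') ∨
    ∃ x, w = f x ∧ (∃ e ∈ E, x ∈ e) ∧ ∃ e ∈ E', x ∈ e := by
  obtain ⟨u, v, ha, he, hw⟩ := h
  obtain ⟨u', v', ha', he', hw'⟩ := h'
  by_cases heq : s(u, v) = s(u', v')
  · exact Or.inl ⟨u, v, ha.ne, he, heq ▸ he'⟩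
  · obtain ⟨x, rfl⟩ := hs.2.2.1 ha ha' heq w hw hw'
    refine Or.inr ⟨x, rfl, ⟨_, he, ?_⟩, ⟨_, he', ?_⟩⟩
    · exact Sym2.mem_iff.2 (hs.2.1 ha x hw)
    · exact Sym2.mem_iff.2 (hs.2.1 ha' x hw')

/-- If the edge sets meet in at most the vertex `x`, then so do their subdivisions. -/
theorem SE_inter_single (hs : IsSubdivisionVia D' D f P) {E E' : Set (Sym2 V)} {w : W} {x : V}
    (hx : ∀ y, (∃ e ∈ E, y ∈ e) → (∃ e ∈ E', y ∈ e) → y = x)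
    (h : w ∈ SE P E) (h' : w ∈ SE P E') : w = f x := by
  rcases SE_inter hs h h' with ⟨u, v, huv, h1, h2⟩ | ⟨y, rfl, h1, h2⟩
  · exact absurd ((hx u ⟨_, h1, by simp⟩ ⟨_, h2, by simp⟩).trans
      (hx v ⟨_, h1, by simp⟩ ⟨_, h2, by simp⟩).symm) huv
  · rw [hx y h1 h2]

theorem SE_edge (hs : IsSubdivisionVia D' D f P) {a b : W} (h : D'.Adj a b) :
    ∃ u v, D.Adj u v ∧ a ∈ SE P {s(u, v)} ∧ b ∈ SE P {s(u, v)} := by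
  obtain ⟨u, v, ha, he⟩ := hs.2.2.2.2 h
  exact ⟨u, v, ha, ⟨u, v, ha, rfl, Walk.fst_mem_support_of_mem_edges _ he⟩,
    ⟨u, v, ha, rfl, Walk.snd_mem_support_of_mem_edges _ he⟩⟩

/-- Restriction of a graph to a set, on the same vertex type. -/
def resG (H : SimpleGraph W) (S : Set W) : SimpleGraph W where
  Adj a b := H.Adj a b ∧ a ∈ S ∧ b ∈ S
  symm := ⟨fun _ _ h => ⟨h.1.symm, h.2.2, h.2.1⟩⟩
  loopless := ⟨fun _ h => h.1.ne rfl⟩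

theorem resG_reach_walk {H : SimpleGraph W} {S : Set W} {a b : W} (p : H.Walk a b)
    (h : ∀ w ∈ p.support, w ∈ S) : (resG H S).Reachable a b := by
  induction p with
  | nil => exact Reachable.refl _
  | cons hadj q ih =>
    refine Reachable.trans (Adj.reachable ?_) (ih fun w hw => h w (by simp [hw]))
    exact ⟨hadj, h _ (by simp), h _ (by simp)⟩

theorem PP_of_reach {H : SimpleGraph W} {S : Set W} {a b : W} (hab : a ≠ b)
    (h : (resG H S).Reachable a b) : ∃ X, X ⊆ S ∧ PP H X a b := by
  obtain ⟨q, hq⟩ := h.exists_walk_length_eq_dist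
  have hmin : ∀ q' : (resG H S).Walk a b, q.length ≤ q'.length := fun q' => hq ▸ dist_le q'
  have hlen : 1 ≤ q.length := by
    rcases Nat.eq_zero_or_pos q.length with h0 | h0
    · exact absurd (Walk.eq_of_length_eq_zero h0) hab
    · exact h0
  have hinj : ∀ i ≤ q.length, ∀ j ≤ q.length, q.getVert i = q.getVert j → ¬ i < j := by
    intro i hi j hj hij hlt
    have := hmin (((q.take i).copy rfl hij).append (q.drop j))
    simp [Walk.take_length, Walk.drop_length] at this
    omega
  have hadj : ∀ i ≤ q.length, ∀ j ≤ q.length, (resG H S).Adj (q.getVert i) (q.getVert j) →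
      ¬ i + 1 < j := by
    intro i hi j hj hij hlt
    have := hmin ((q.take i).append (Walk.cons hij (q.drop j)))
    simp [Walk.take_length, Walk.drop_length] at this
    omega
  have hmem : ∀ i ≤ q.length, q.getVert i ∈ S := by
    intro i hi
    rcases hi.lt_or_eq with h1 | h1
    · exact (q.adj_getVert_succ h1).2.1
    · obtain ⟨k, rfl⟩ : ∃ k, i = k + 1 := ⟨i - 1, by omega⟩
      exact (q.adj_getVert_succ (i := k) (by omega)).2.2
  refine ⟨{w | ∃ i ≤ q.length, q.getVert i = w}, ?_, q.length, q.getVert, hlen, by simp, by simp,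
    ?_, fun w => Iff.rfl, ?_⟩
  · rintro w ⟨i, hi, rfl⟩; exact hmem i hi
  · intro i hi j hj hij
    have h1 := hinj i hi j hj hij
    have h2 := hinj j hj i hi hij.symm
    omega
  · intro i hi j hj
    constructor
    · intro h
      have h1 := hadj i hi j hj ⟨h, hmem i hi, hmem j hj⟩
      have h2 := hadj j hj i hi ⟨h.symm, hmem j hj, hmem i hi⟩
      have h3 : i ≠ j := by rintro rfl; exact h.ne rfl
      omega
    · rintro (rfl | rfl)
      · exact (q.adj_getVert_succ (by omega)).1
      · exact (q.adj_getVert_succ (by omega)).1.symm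

theorem SE_path {u v : V} (p : D.Walk u v) (huv : u ≠ v) :
    ∃ X, X ⊆ SE P {e | e ∈ p.edges} ∧ PP D' X (f u) (f v) := by
  apply PP_of_reach (f.injective.ne huv)
  suffices ∀ S : Set (Sym2 V), (∀ e ∈ p.edges, e ∈ S) → (resG D' (SE P S)).Reachable (f u) (f v) from
    this _ (fun e he => he)
  intro S
  clear huv
  induction p with
  | nil => intro _; exact Reachable.refl _
  | cons hadj q ih =>
    intro hS
    refine Reachable.trans (resG_reach_walk (P hadj) ?_) (ih fun e he => hS e (by simp [he]))
    intro w hw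
    exact ⟨_, _, hadj, hS _ (by simp), hw⟩

/-- the six walks' edges -/
def Type4K4Core.E (c : Type4K4Core D) : Fin 4 → Fin 4 → Set (Sym2 V) :=
  ![![∅, {e | e ∈ c.adj_xy.toWalk.edges}, {e | e ∈ c.adj_xz.toWalk.edges}, {e | e ∈ c.Pxw.edges}],
    ![{e | e ∈ c.adj_xy.toWalk.edges}, ∅, {e | e ∈ c.Pyz.edges}, {e | e ∈ c.Pyw.edges}],
    ![{e | e ∈ c.adj_xz.toWalk.edges}, {e | e ∈ c.Pyz.edges}, ∅, {e | e ∈ c.Pzw.edges}],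
    ![{e | e ∈ c.Pxw.edges}, {e | e ∈ c.Pyw.edges}, {e | e ∈ c.Pzw.edges}, ∅]]

/-- branch vertices -/
def Type4K4Core.bv (c : Type4K4Core D) : Fin 4 → V := ![c.x, c.y, c.z, c.w]

/-- the six walks' vertices -/
def Type4K4Core.N (c : Type4K4Core D) : Fin 4 → Fin 4 → Set V :=
  ![![∅, {c.x, c.y}, {c.x, c.z}, {e | e ∈ c.Pxw.support}],
    ![{c.x, c.y}, ∅, {e | e ∈ c.Pyz.support}, {e | e ∈ c.Pyw.support}],
    ![{c.x, c.z}, {e | e ∈ c.Pyz.support}, ∅, {e | e ∈ c.Pzw.support}],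
    ![{e | e ∈ c.Pxw.support}, {e | e ∈ c.Pyw.support}, {e | e ∈ c.Pzw.support}, ∅]]

theorem Type4K4Core.E_symm (c : Type4K4Core D) (i j : Fin 4) : c.E i j = c.E j i := by
  fin_cases i <;> fin_cases j <;> rfl

theorem Type4K4Core.N_symm (c : Type4K4Core D) (i j : Fin 4) : c.N i j = c.N j i := by
  fin_cases i <;> fin_cases j <;> rfl

theorem mem_support_of_mem_edges' {u v : V} (p : D.Walk u v) {e : Sym2 V} (he : e ∈ p.edges)
    {x : V} (hx : x ∈ e) : x ∈ p.support := by
  induction e with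
  | _ a b =>
    rcases Sym2.mem_iff.1 hx with rfl | rfl
    · exact Walk.fst_mem_support_of_mem_edges _ he
    · exact Walk.snd_mem_support_of_mem_edges _ he

theorem Type4K4Core.E_N (c : Type4K4Core D) (i j : Fin 4) {e : Sym2 V} (he : e ∈ c.E i j)
    {x : V} (hx : x ∈ e) : x ∈ c.N i j := by
  have := @mem_support_of_mem_edges' V D
  fin_cases i <;> fin_cases j <;> first
    | exact this _ he hx
    | exact absurd he (Set.notMem_empty _)
    | (have h := this _ he hx; simpa [Type4K4Core.N] using h)

theorem Type4K4Core.N_inter (c : Type4K4Core D) (i j k l : Fin 4) (hij : i < j) (hkl : k < l) {x : V}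
    (h1 : x ∈ c.N i j) (h2 : x ∈ c.N k l) :
    (i = k ∧ j = l) ∨ (i = l ∧ j = k) ∨ ∃ m, x = c.bv m ∧ (m = i ∨ m = j) ∧ (m = k ∨ m = l) := by
  have e1 := c.Pxw.start_mem_support
  have e2 := c.Pxw.end_mem_support
  have e3 := c.Pyz.start_mem_support
  have e4 := c.Pyz.end_mem_support
  have e5 := c.Pyw.start_mem_support
  have e6 := c.Pyw.end_mem_support
  have e7 := c.Pzw.start_mem_support
  have e8 := c.Pzw.end_mem_support
  have d1 := c.d₁ x
  have d2 := c.d₂ x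
  have d3 := c.d₃ x
  have d4 := c.d₄ x
  have d5 := c.d₅ x
  have d6 := c.d₆ x
  have n1 := c.ne_xy
  have n2 := c.ne_xz
  have n3 := c.ne_xw
  have n4 := c.ne_yz
  have n5 := c.ne_yw
  have n6 := c.ne_zw
  fin_cases i <;> fin_cases j <;> first
    | exact absurd hij (by decide)
    | (fin_cases k <;> fin_cases l <;> first
        | exact absurd hkl (by decide)
        | exact Or.inl ⟨rfl, rfl⟩
        | (right; right
           simp [Type4K4Core.N] at h1 h2
           first
            | (refine ⟨0, ?_, by decide, by decide⟩; simp [Type4K4Core.bv]; grind)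
            | (refine ⟨1, ?_, by decide, by decide⟩; simp [Type4K4Core.bv]; grind)
            | (refine ⟨2, ?_, by decide, by decide⟩; simp [Type4K4Core.bv]; grind)
            | (refine ⟨3, ?_, by decide, by decide⟩; simp [Type4K4Core.bv]; grind)
            | (exfalso; grind)))

theorem Type4K4Core.N_inter' (c : Type4K4Core D) (i j k l : Fin 4) (hij : i ≠ j) (hkl : k ≠ l) {x : V}
    (h1 : x ∈ c.N i j) (h2 : x ∈ c.N k l) :
    (i = k ∧ j = l) ∨ (i = l ∧ j = k) ∨ ∃ m, x = c.bv m ∧ (m = i ∨ m = j) ∧ (m = k ∨ m = l) := by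
  rcases lt_or_gt_of_ne hij with hij | hij <;> rcases lt_or_gt_of_ne hkl with hkl | hkl
  · exact c.N_inter i j k l hij hkl h1 h2
  · rw [c.N_symm] at h2
    have := c.N_inter i j l k hij hkl h1 h2
    grind
  · rw [c.N_symm] at h1
    have := c.N_inter j i k l hij hkl h1 h2
    grind
  · rw [c.N_symm] at h1 h2
    have := c.N_inter j i l k hij hkl h1 h2
    grind

theorem Type4K4Core.E_sub (c : Type4K4Core D) (i j : Fin 4) : c.E i j ⊆ c.edges := by
  intro e he
  fin_cases i <;> fin_cases j <;> simp [Type4K4Core.E] at he <;> simp [Type4K4Core.edges, he]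

theorem Type4K4Core.edges_E (c : Type4K4Core D) {e : Sym2 V} (he : e ∈ c.edges) :
    ∃ i j, i ≠ j ∧ e ∈ c.E i j := by
  rcases he with h | h | h | h | h | h
  · exact ⟨0, 3, by decide, h⟩
  · exact ⟨1, 2, by decide, h⟩
  · exact ⟨1, 3, by decide, h⟩
  · exact ⟨2, 3, by decide, h⟩
  · exact ⟨0, 1, by decide, by simp [Type4K4Core.E, h]⟩
  · exact ⟨0, 2, by decide, by simp [Type4K4Core.E, h]⟩

theorem Type4K4Core.edges_supp (c : Type4K4Core D) {e : Sym2 V} (he : e ∈ c.edges) {x : V}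
    (hx : x ∈ e) : x ∈ c.supp := by
  have := @mem_support_of_mem_edges' V D
  rcases he with h | h | h | h | rfl | rfl
  · exact Or.inl (this _ h hx)
  · exact Or.inr (Or.inl (this _ h hx))
  · exact Or.inr (Or.inr (Or.inl (this _ h hx)))
  · exact Or.inr (Or.inr (Or.inr (this _ h hx)))
  · rcases Sym2.mem_iff.1 hx with rfl | rfl
    · exact Or.inl (by simp)
    · exact Or.inr (Or.inl (by simp))
  · rcases Sym2.mem_iff.1 hx with rfl | rfl
    · exact Or.inl (by simp)
    · exact Or.inr (Or.inl (by simp))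

theorem Type4K4Core.bv_inj (c : Type4K4Core D) (i j : Fin 4) (h : c.bv i = c.bv j) : i = j := by
  have n1 := c.ne_xy
  have n2 := c.ne_xz
  have n3 := c.ne_xw
  have n4 := c.ne_yz
  have n5 := c.ne_yw
  have n6 := c.ne_zw
  fin_cases i <;> fin_cases j <;> simp [Type4K4Core.bv] at h ⊢ <;> grind

theorem path_edge_ends {u v : V} (p : D.Walk u v) (hp : p.IsPath) (hl : 2 ≤ p.length) :
    s(u, v) ∉ p.edges := by
  cases p with
  | nil => simp
  | @cons _ t _ hadj q =>
    rw [Walk.cons_isPath_iff] at hp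
    intro he
    rw [Walk.edges_cons, List.mem_cons] at he
    rcases he with he | he
    · rw [Sym2.eq_iff] at he
      have : v = t := by
        rcases he with h | h
        · exact h.2
        · exact absurd (h.1 ▸ q.start_mem_support) hp.2
      subst this
      have h0 := Walk.isPath_iff_nil.1 hp.1
      have h1 := Walk.nil_iff_length_eq.1 h0
      rw [Walk.length_cons] at hl
      omega
    · exact hp.2 (Walk.fst_mem_support_of_mem_edges _ he)

end subdiv

section subdiv2
variable {V W : Type} {D : SimpleGraph V} {D' : SimpleGraph W} {f : V ↪ W}
  {P : ∀ ⦃u v : V⦄, D.Adj u v → D'.Walk (f u) (f v)}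

theorem Type4K4Core.bv_mem_N (c : Type4K4Core D) (i j : Fin 4) (hij : i ≠ j) : c.bv i ∈ c.N i j := by
  fin_cases i <;> fin_cases j <;> simp [Type4K4Core.bv, Type4K4Core.N] at hij ⊢

theorem Type4K4Core.bv_supp (c : Type4K4Core D) (i : Fin 4) : c.bv i ∈ c.supp := by
  fin_cases i <;> simp [Type4K4Core.bv, Type4K4Core.supp]

theorem Type4K4Core.nadj (c : Type4K4Core D) (i j : Fin 4) (hi : i ≠ 0) (hj : j ≠ 0) (hij : i ≠ j) :
    s(c.bv i, c.bv j) ∉ c.E i j := by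
  have h1 := path_edge_ends _ c.Pyz_path c.Pyz_len
  have h2 := path_edge_ends _ c.Pyw_path c.Pyw_len
  have h3 := path_edge_ends _ c.Pzw_path c.Pzw_len
  have h1' := h1
  have h2' := h2
  have h3' := h3
  rw [Sym2.eq_swap] at h1' h2' h3'
  fin_cases i <;> fin_cases j <;> first
    | exact absurd rfl hi
    | exact absurd rfl hj
    | exact absurd rfl hij
    | assumption

theorem Type4K4Core.toK4S (c : Type4K4Core D) (hs : IsSubdivisionVia D' D f P) {F : Set (Sym2 V)}
    (hcov : ∀ p q, D.Adj p q → s(p, q) ∈ c.edges ∨ s(p, q) ∈ F)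
    (hF : ∀ e ∈ F, ∀ v ∈ e, v ∈ c.supp → v = c.x) :
    ∃ X, K4S D' (fun i => f (c.bv i)) X ∧ ∀ i j, i ≠ j → X i j ⊆ SE P c.edges := by
  have hFS : ∀ w, w ∈ SE P c.edges → w ∈ SE P F → w = f c.x := by
    intro w h h'
    refine SE_inter_single hs ?_ h h'
    rintro y ⟨e, he, hy⟩ ⟨e', he', hy'⟩
    exact hF e' he' y hy' (c.edges_supp he hy)
  have := K4S.of_sets (H := D') (b := fun i => f (c.bv i)) (S := fun i j => SE P (c.E i j))
    (fun i j h => c.bv_inj i j (f.injective h)) (fun i j => by rw [c.E_symm]) ?_ ?_ ?_ ?_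
  · obtain ⟨X, hX, hX'⟩ := this
    exact ⟨X, hX, fun i j hij => (hX' i j hij).trans (SE_mono (c.E_sub i j))⟩
  · intro i j hij
    have := @SE_path V W D D' f P
    fin_cases i <;> fin_cases j <;> first
      | exact absurd hij (by decide)
      | exact this c.adj_xy.toWalk c.ne_xy
      | exact this c.adj_xz.toWalk c.ne_xz
      | exact this c.Pxw c.ne_xw
      | exact this c.Pyz c.ne_yz
      | exact this c.Pyw c.ne_yw
      | exact this c.Pzw c.ne_zw
  · intro i j k l hij hkl w h1 h2
    rcases SE_inter hs h1 h2 with ⟨u, v, huv, he1, he2⟩ | ⟨x, rfl, ⟨e, he, hx⟩, ⟨e', he', hx'⟩⟩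
    · have h3 := c.N_inter' i j k l hij hkl (c.E_N _ _ he1 (x := u) (by simp)) (c.E_N _ _ he2 (by simp))
      have h4 := c.N_inter' i j k l hij hkl (c.E_N _ _ he1 (x := v) (by simp)) (c.E_N _ _ he2 (by simp))
      grind
    · have h3 := c.N_inter' i j k l hij hkl (c.E_N _ _ he hx) (c.E_N _ _ he' hx')
      rcases h3 with h | h | ⟨m, rfl, h⟩
      · exact Or.inl h
      · exact Or.inr (Or.inl h)
      · exact Or.inr (Or.inr ⟨m, rfl, h⟩)
  · intro i j k l hij hkl u v hu hv huv
    obtain ⟨p, q, hpq, h1, h2⟩ := SE_edge hs huv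
    rcases hcov p q hpq with h | h
    · obtain ⟨i', j', hne, hE⟩ := c.edges_E h
      have hsub : ({s(p, q)} : Set (Sym2 V)) ⊆ c.E i' j' := by simpa using hE
      exact ⟨i', j', hne, SE_mono hsub h1, SE_mono hsub h2⟩
    · exfalso
      have hsub : ({s(p, q)} : Set (Sym2 V)) ⊆ F := by simpa using h
      have e1 := hFS u (SE_mono (c.E_sub _ _) hu) (SE_mono hsub h1)
      have e2 := hFS v (SE_mono (c.E_sub _ _) hv) (SE_mono hsub h2)
      exact huv.ne (e1.trans e2.symm)
  · intro i j hi hj hadj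
    have hij : i ≠ j := by rintro rfl; exact hadj.ne rfl
    have hbij : c.bv i ≠ c.bv j := fun h => hij (c.bv_inj _ _ h)
    obtain ⟨p, q, hpq, ⟨p1, q1, a1, s1, m1⟩, ⟨p2, q2, a2, s2, m2⟩⟩ := SE_edge hs hadj
    have k1 := Sym2.mem_iff.2 (hs.2.1 a1 _ m1)
    have k2 := Sym2.mem_iff.2 (hs.2.1 a2 _ m2)
    rw [s1] at k1
    rw [s2] at k2
    have hE := (Sym2.mem_and_mem_iff hbij).1 ⟨k1, k2⟩
    have hc := hcov p q hpq
    rw [hE] at hc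
    rcases hc with h | h
    · obtain ⟨i', j', hne, h'⟩ := c.edges_E h
      have g1 := c.N_inter' i j i' j' hij hne (c.bv_mem_N i j hij) (c.E_N _ _ h' (by simp))
      have g2 := c.N_inter' i j i' j' hij hne (c.N_symm i j ▸ c.bv_mem_N j i hij.symm) (c.E_N _ _ h' (by simp))
      have inj := c.bv_inj
      have : (i = i' ∧ j = j') ∨ (i = j' ∧ j = i') := by
        rcases g1 with g1 | g1 | ⟨m, hm, g1, g1'⟩
        · exact Or.inl g1
        · exact Or.inr g1
        rcases g2 with g2 | g2 | ⟨m', hm', g2, g2'⟩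
        · exact Or.inl g2
        · exact Or.inr g2
        have := inj _ _ hm
        have := inj _ _ hm'
        grind
      apply c.nadj i j hi hj hij
      rcases this with ⟨rfl, rfl⟩ | ⟨rfl, rfl⟩
      · exact h'
      · rw [c.E_symm]; exact h'
    · have e1 := hF _ h (c.bv i) (by simp) (c.bv_supp i)
      have e2 := hF _ h (c.bv j) (by simp) (c.bv_supp j)
      exact hbij (e1.trans e2.symm)

/-- One direction: everything of the second core is above the pivot of the first. -/
theorem half {A le : W → W → Prop} (B : BOrd D' A le) (hs : IsSubdivisionVia D' D f P)
    (c₁ c₂ : Type4K4Core D) (Q : D.Walk c₁.x c₂.x) {F : Set (Sym2 V)}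
    (hcov : ∀ p q, D.Adj p q → s(p, q) ∈ c₁.edges ∨ s(p, q) ∈ F)
    (hF : ∀ e ∈ F, ∀ v ∈ e, v ∈ c₁.supp → v = c₁.x)
    (hQF : ∀ e ∈ Q.edges, e ∈ F) (h2F : c₂.edges ⊆ F)
    {X₂ : Fin 4 → Fin 4 → Set W} (K₂ : K4S D' (fun i => f (c₂.bv i)) X₂)
    (hX₂ : ∀ i j, i ≠ j → X₂ i j ⊆ SE P c₂.edges) {v : W} (hv : v ∈ SE P c₁.edges)
    (hvx : f c₁.x ≠ v) (hvn : ¬ D'.Adj v (f c₁.x)) (hle : le v (f c₁.x)) :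
    ∀ i j, i ≠ j → ∀ t ∈ X₂ i j, le v t ∧ t ≠ v := by
  have hFS : ∀ w, w ∈ SE P c₁.edges → w ∈ SE P F → w = f c₁.x := by
    intro w h h'
    refine SE_inter_single hs ?_ h h'
    rintro y ⟨e, he, hy⟩ ⟨e', he', hy'⟩
    exact hF e' he' y hy' (c₁.edges_supp he hy)
  have hd : ∀ d ∈ SE P F, d ≠ v ∧ ¬ A d v := by
    intro d hd
    refine ⟨?_, ?_⟩
    · rintro rfl
      exact hvx (hFS d hv hd).symm
    · intro ha
      have hadj := (B.adj d v).2 (Or.inl ha)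
      obtain ⟨p, q, hpq, h1, h2⟩ := SE_edge hs hadj
      rcases hcov p q hpq with h | h
      · have hsub : ({s(p, q)} : Set (Sym2 V)) ⊆ c₁.edges := by simpa using h
        have := hFS d (SE_mono hsub h1) hd
        subst this
        exact hvn hadj.symm
      · have hsub : ({s(p, q)} : Set (Sym2 V)) ⊆ F := by simpa using h
        exact hvx (hFS v hv (SE_mono hsub h2)).symm
  have hx2 : le v (f c₂.x) ∧ f c₂.x ≠ v := by
    by_cases hxx : c₁.x = c₂.x
    · rw [← hxx]; exact ⟨hle, hvx⟩
    · obtain ⟨X, hX, hP⟩ := SE_path (P := P) Q hxx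
      exact up_all B hP ⟨hle, hvx⟩ (fun d hdX => hd d (SE_mono hQF (hX hdX))) _ hP.right
  have hstep : ∀ i j, i ≠ j → (le v (f (c₂.bv i)) ∧ f (c₂.bv i) ≠ v) →
      ∀ t ∈ X₂ i j, le v t ∧ t ≠ v := fun i j hij h =>
    up_all B (K₂.pp i j hij) h (fun d hdX => hd d (SE_mono h2F (hX₂ i j hij hdX)))
  intro i j hij
  apply hstep i j hij
  by_cases hi : i = 0
  · subst hi; exact hx2
  · exact hstep 0 i (Ne.symm hi) hx2 _ (K₂.pp 0 i (Ne.symm hi)).right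

theorem core_pivot {A le : W → W → Prop} (B : BOrd D' A le)
    (c : Type4K4Core D) {X : Fin 4 → Fin 4 → Set W} (K : K4S D' (fun i => f (c.bv i)) X) :
    ∃ v, (∃ i j, i ≠ j ∧ v ∈ X i j) ∧ f c.x ≠ v ∧ ¬ D'.Adj v (f c.x) ∧ le v (f c.x) := by
  obtain ⟨j, k, v, s, a, hj, hk, hjk, h, h1, h2, h3⟩ := K.main B
  have hx : f c.x ∈ Tri X 0 j k := Or.inl (Or.inl (K.pp 0 j hj.symm).left)
  refine ⟨v, K4S.tri_mem X hj.symm hk.symm hjk h.hv, h2, ?_, h.sub _ hx h1 h2 h3⟩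
  intro hadj
  rcases h.nbv _ hx hadj with h4 | h4
  · exact h1 h4
  · exact h3 h4

theorem no_burling_subdivision (c₁ c₂ : Type4K4Core D)
    (hdisj : ∀ v, v ∈ c₁.supp → v ∈ c₂.supp → v = c₁.x ∧ v = c₂.x)
    (Q : D.Walk c₁.x c₂.x)
    (hQ₁ : ∀ w ∈ Q.support, w ∈ c₁.supp → w = c₁.x)
    (hQ₂ : ∀ w ∈ Q.support, w ∈ c₂.supp → w = c₂.x)
    (hcovE : ∀ p q, D.Adj p q → s(p, q) ∈ c₁.edges ∨ s(p, q) ∈ c₂.edges ∨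
      s(p, q) ∈ Q.edges) (hsub : IsSubdivision D' D) : ¬ IsBurlingGraph D' := by
  intro hB
  obtain ⟨f, P, hs⟩ := hsub
  obtain ⟨A, le, B⟩ := exists_BOrd hB
  obtain ⟨F₁, hF₁⟩ : ∃ F₁ : Set (Sym2 V), ∀ e, e ∈ F₁ ↔ e ∈ c₂.edges ∨ e ∈ Q.edges := ⟨{e | _}, fun e => Iff.rfl⟩
  obtain ⟨F₂, hF₂⟩ : ∃ F₂ : Set (Sym2 V), ∀ e, e ∈ F₂ ↔ e ∈ c₁.edges ∨ e ∈ Q.edges := ⟨{e | _}, fun e => Iff.rfl⟩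
  have cov1 : ∀ p q, D.Adj p q → s(p, q) ∈ c₁.edges ∨ s(p, q) ∈ F₁ := by
    intro p q h; rw [hF₁]; exact hcovE p q h
  have cov2 : ∀ p q, D.Adj p q → s(p, q) ∈ c₂.edges ∨ s(p, q) ∈ F₂ := by
    intro p q h; rw [hF₂]; have := hcovE p q h; tauto
  have f1 : ∀ e ∈ F₁, ∀ v ∈ e, v ∈ c₁.supp → v = c₁.x := by
    intro e he v hv hc
    rcases (hF₁ e).1 he with h | h
    · exact (hdisj v hc (c₂.edges_supp h hv)).1
    · exact hQ₁ v (mem_support_of_mem_edges' _ h hv) hc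
  have f2 : ∀ e ∈ F₂, ∀ v ∈ e, v ∈ c₂.supp → v = c₂.x := by
    intro e he v hv hc
    rcases (hF₂ e).1 he with h | h
    · exact (hdisj v (c₁.edges_supp h hv) hc).2
    · exact hQ₂ v (mem_support_of_mem_edges' _ h hv) hc
  obtain ⟨X₁, K₁, hX₁⟩ := c₁.toK4S hs cov1 f1
  obtain ⟨X₂, K₂, hX₂⟩ := c₂.toK4S hs cov2 f2
  obtain ⟨v₁, ⟨i₁, j₁, n₁, m₁⟩, a₁, b₁, l₁⟩ := core_pivot B c₁ K₁
  obtain ⟨v₂, ⟨i₂, j₂, n₂, m₂⟩, a₂, b₂, l₂⟩ := core_pivot B c₂ K₂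
  have r1 := half B hs c₁ c₂ Q cov1 f1 (fun e he => (hF₁ e).2 (Or.inr he))
    (fun e he => (hF₁ e).2 (Or.inl he)) K₂ hX₂ (hX₁ _ _ n₁ m₁) a₁ b₁ l₁ _ _ n₂ _ m₂
  have r2 := half B hs c₂ c₁ Q.reverse cov2 f2 (fun e he => (hF₂ e).2 (Or.inr (by simpa using he)))
    (fun e he => (hF₂ e).2 (Or.inl he)) K₁ hX₁ (hX₂ _ _ n₂ m₂) a₂ b₂ l₂ _ _ n₁ _ m₁
  exact r1.2 (B.antisymm _ _ r2.1 r1.1)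

end subdiv2


theorem IsBurlingGraph.copy {U V : Type} {S : SimpleGraph U} {G : SimpleGraph V}
    (hG : IsBurlingGraph G) (h : InducedCopy S G) : IsBurlingGraph S := by
  obtain ⟨A, ⟨hA1, hA2⟩, T, V', f, hf⟩ := hG
  obtain ⟨g, hg⟩ := h
  refine ⟨fun a b => A (g a) (g b), ⟨fun u v h => (hg u v).2 (hA1 _ _ h), fun u v h => hA2 _ _ ((hg u v).1 h)⟩,
    T, V', g.trans f, fun u v => hf _ _⟩

theorem IsBurlingGraph.triangle_free {V : Type} {G : SimpleGraph V} (hG : IsBurlingGraph G) :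
    G.CliqueFree 3 := by
  obtain ⟨A, le, B⟩ := exists_BOrd hG
  have key : ∀ a b c, A a b → A a c → ¬ G.Adj b c := by
    intro a b c h1 h2 h3
    rcases B.chain a b c h1 h2 with h | h
    · exact B.nadj _ _ h3 h
    · exact B.nadj _ _ h3.symm h
  classical
  intro s hs
  obtain ⟨a, b, c, hab, hac, hbc, -⟩ := is3Clique_iff.1 hs
  have cyc : ∀ a b c, A a b → A b c → A c a → False := by
    intro a b c h1 h2 h3
    obtain ⟨r, hr⟩ := B.rank
    have := hr _ _ h1
    have := hr _ _ h2
    have := hr _ _ h3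
    omega
  have e1 := (B.adj _ _).1 hab
  have e2 := (B.adj _ _).1 hac
  have e3 := (B.adj _ _).1 hbc
  rcases e1 with e1 | e1 <;> rcases e2 with e2 | e2 <;> rcases e3 with e3 | e3
  · exact key _ _ _ e1 e2 hbc
  · exact key _ _ _ e1 e2 hbc
  · exact cyc _ _ _ e1 e3 e2
  · exact key _ _ _ e2 e3 hab
  · exact key _ _ _ e1 e3 hac
  · exact cyc _ _ _ e1 e2 e3
  · exact key _ _ _ e1 e3 hac
  · exact key _ _ _ e2 e3 hab

theorem cliqueNumber_le_two {V : Type} {G : SimpleGraph V} (h : G.CliqueFree 3) :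
    cliqueNumber G ≤ 2 := by
  apply csSup_le'
  rintro n ⟨s, hs⟩
  by_contra hn
  exact (h.mono (by omega : 3 ≤ n)) s hs


/-- Choice sets of the universal Burling tree. -/
def uChoose : List ℕ → Set (List ℕ)
  | [] => ∅
  | 0 :: _ => ∅
  | (n + 1) :: v => {w | ∃ m, m <:+ Denumerable.ofNat (List ℕ) n ∧ w = m ++ 0 :: v}

/-- The universal Burling tree. -/
def uTree : BurlingTree (List ℕ) where
  parent := List.tail
  root := []
  parent_root := rfl
  reach := by
    intro v
    induction v with
    | nil => exact ⟨0, rfl⟩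
    | cons a v ih =>
      obtain ⟨n, hn⟩ := ih
      exact ⟨n + 1, by rw [Function.iterate_succ_apply]; exact hn⟩
  lastBorn := fun v => 0 :: v
  lastBorn_child := by
    intro v _
    refine ⟨rfl, fun h => ?_⟩
    have := congrArg List.length h
    simp at this
  choosePath := uChoose
  choosePath_empty := by
    rintro v (rfl | h)
    · rfl
    · rw [h]; rfl
  choosePath_branch := by
    intro v h1 h2
    match v, h1, h2 with
    | [], h1, _ => exact absurd rfl h1
    | 0 :: v, _, h2 => exact absurd rfl h2
    | (n + 1) :: v, _, _ =>
      right
      refine ⟨⟨[], List.nil_suffix, rfl⟩, ?_, ?_⟩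
      · rintro w ⟨m, hm, rfl⟩ hne
        cases m with
        | nil => exact absurd rfl hne
        | cons a m =>
          refine ⟨⟨m, (List.suffix_cons a m).trans hm, rfl⟩, fun h => ?_⟩
          have := congrArg List.length h
          simp at this
      · rintro w ⟨m, hm, rfl⟩ w' ⟨m', hm', rfl⟩ hne hne' h
        cases m with
        | nil => exact absurd rfl hne
        | cons a m =>
          cases m' with
          | nil => exact absurd rfl hne'
          | cons a' m' =>
            have h3 : m = m' := List.append_cancel_right h
            subst h3
            have h4 := (List.suffix_of_suffix_length_le hm hm' (by simp)).eq_of_length (by simp)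
            rw [h4]

/-- The universal Burling graph. -/
def uGraph : SimpleGraph (List ℕ) where
  Adj u v := uTree.Arc u v ∨ uTree.Arc v u
  symm := ⟨fun _ _ h => h.symm⟩
  loopless := ⟨fun u h => by
    have : uTree.Arc u u := by tauto
    exact absurd (uTree.arc_rk this) (lt_irrefl _)⟩

theorem uGraph_burling : IsBurlingGraph uGraph := by
  refine ⟨uTree.Arc, ⟨fun u v h => Or.inl h, fun u v h => ⟨fun h1 h2 => ?_, fun h1 => ?_⟩⟩,
    List ℕ, uTree, Function.Embedding.refl _, fun u v => Iff.rfl⟩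
  · have := uTree.arc_rk h1
    have := uTree.arc_rk h2
    omega
  · rcases h with h | h
    · exact h
    · exact absurd h h1

theorem uGraph_not_colorable (k : ℕ) : ¬ uGraph.Colorable k := by
  rintro ⟨col⟩
  obtain ⟨C, hC⟩ : ∃ C : List ℕ → List ℕ → Set (Fin k),
      ∀ v m c, c ∈ C v m ↔ ∃ s, s <:+ m ∧ c = col (s ++ v) :=
    ⟨fun v m => {c | ∃ s, s <:+ m ∧ c = col (s ++ v)}, fun _ _ _ => Iff.rfl⟩
  have hmono : ∀ v m m', m <:+ m' → C v m ⊆ C v m' := by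
    intro v m m' h c hc
    obtain ⟨s, hs, rfl⟩ := (hC _ _ _).1 hc
    exact (hC _ _ _).2 ⟨s, hs.trans h, rfl⟩
  have main : ∀ j v, ∃ m, j ≤ (C v m).ncard := by
    intro j
    induction j with
    | zero => exact fun v => ⟨[], Nat.zero_le _⟩
    | succ j ih =>
      intro v0
      by_contra hcon
      push Not at hcon
      obtain ⟨m0, hm0⟩ := ih v0
      obtain ⟨m1, hm1⟩ := ih (0 :: (m0 ++ v0))
      have hall : ∀ m, m0 <:+ m → C v0 m0 = C v0 m := fun m hm =>
        Set.eq_of_subset_of_ncard_le (hmono _ _ _ hm) (by have := hcon m; omega) (Set.toFinite _)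
      have hsub : C (0 :: (m0 ++ v0)) m1 ⊆ C v0 (m1 ++ 0 :: m0) := by
        intro c hc
        obtain ⟨s, hs, rfl⟩ := (hC _ _ _).1 hc
        refine (hC _ _ _).2 ⟨s ++ 0 :: m0, ?_, by simp⟩
        obtain ⟨t, rfl⟩ := hs
        exact ⟨t, by simp⟩
      have heq : C (0 :: (m0 ++ v0)) m1 = C v0 m0 := by
        rw [hall (m1 ++ 0 :: m0) ⟨m1 ++ [0], by simp⟩]
        exact Set.eq_of_subset_of_ncard_le hsub (by have := hcon (m1 ++ 0 :: m0); omega) (Set.toFinite _)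
      have hu : col ((Encodable.encode m1 + 1) :: (m0 ++ v0)) ∈ C (0 :: (m0 ++ v0)) m1 := by
        rw [heq, hall ((Encodable.encode m1 + 1) :: m0) (List.suffix_cons _ _)]
        exact (hC _ _ _).2 ⟨_, List.suffix_rfl, rfl⟩
      obtain ⟨s, hs, hs'⟩ := (hC _ _ _).1 hu
      refine col.valid (v := (Encodable.encode m1 + 1) :: (m0 ++ v0)) (w := s ++ 0 :: (m0 ++ v0)) (Or.inl ?_) hs'
      exact ⟨s, by rw [Denumerable.ofNat_encode]; exact hs, rfl⟩
  obtain ⟨m, hm⟩ := main (k + 1) []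
  have := Set.ncard_le_card (C [] m)
  simp at this
  omega

theorem exists_burling_not_colorable (k : ℕ) :
    ∃ (V : Type) (_ : Fintype V) (G : SimpleGraph V), IsBurlingGraph G ∧ ¬ G.Colorable k := by
  by_contra hcon
  push Not at hcon
  apply uGraph_not_colorable k
  refine nonempty_hom_of_forall_finite_subgraph_hom (F := (⊤ : SimpleGraph (Fin k))) ?_
  intro G' hfin
  have hc : (uGraph.induce G'.verts).Colorable k :=
    hcon _ hfin.fintype _ (uGraph_burling.copy ⟨Function.Embedding.subtype _, fun a b => Iff.rfl⟩)
  have col := Classical.choice hc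
  exact ⟨fun x => col x, fun {a b} h => col.map_rel' (G'.adj_sub h)⟩

theorem not_weaklyPervasive_of {V : Type} {D : SimpleGraph V}
    (h : ∀ (W : Type) (D' : SimpleGraph W), IsSubdivision D' D → ¬ IsBurlingGraph D') :
    ¬ WeaklyPervasive D := by
  rintro ⟨f, hf⟩
  obtain ⟨W, hW, G, hG, hcol⟩ := exists_burling_not_colorable (f 0 + f 1 + f 2)
  have h1 := hf W hW G (fun U S hS hcopy => h U S hS (hG.copy hcopy))
  have h2 := cliqueNumber_le_two hG.triangle_free
  apply hcol
  rw [← chromaticNumber_le_iff_colorable]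
  refine h1.trans ?_
  have : f (cliqueNumber G) ≤ f 0 + f 1 + f 2 := by
    interval_cases cliqueNumber G <;> omega
  exact_mod_cast this


/-- a dumbbell of two Burling-admissible type-4 subdivisions of `K₄`, joined by
a path between the common endpoints `x₁` and `x₂` of the non-subdivided edges, has no
subdivision which is a Burling graph, and consequently is not weakly pervasive. -/
theorem dumbbell_type4K4_not_weaklyPervasive (V : Type) (D : SimpleGraph V)
    (c₁ c₂ : Type4K4Core D)
    (hdisj : ∀ v, v ∈ c₁.supp → v ∈ c₂.supp → v = c₁.x ∧ v = c₂.x)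
    (Q : D.Walk c₁.x c₂.x) (hQ : Q.IsPath)
    (hQ₁ : ∀ w ∈ Q.support, w ∈ c₁.supp → w = c₁.x)
    (hQ₂ : ∀ w ∈ Q.support, w ∈ c₂.supp → w = c₂.x)
    (hcovV : ∀ v : V, v ∈ c₁.supp ∨ v ∈ c₂.supp ∨ v ∈ Q.support)
    (hcovE : ∀ p q, D.Adj p q → s(p, q) ∈ c₁.edges ∨ s(p, q) ∈ c₂.edges ∨
      s(p, q) ∈ Q.edges) :
    (∀ (W : Type) (D' : SimpleGraph W), IsSubdivision D' D → ¬ IsBurlingGraph D') ∧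
    ¬ WeaklyPervasive D := by
  have h : ∀ (W : Type) (D' : SimpleGraph W), IsSubdivision D' D → ¬ IsBurlingGraph D' :=
    fun _ _ hs => no_burling_subdivision c₁ c₂ hdisj Q hQ₁ hQ₂ hcovE hs
  exact ⟨h, not_weaklyPervasive_of h⟩

end BurlingFormal
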